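/- arXiv:0704.2644 — 4 statements merged into one kernel-verified Lean document; each statement's English description precedes it below -/
import Mathlib

section
/- Let N ≥ 1, s ≥ 1, and let 𝒞 = { A_ξ : ξ ∈ ℝ^N } be a collection of subsets of ℝ^d of the form A_ξ = { z ∈ ℝ^d : Π(z, ξ) > 0 }, where for each fixed z ∈ ℝ^d the map ξ ↦ Π(z, ξ) is a polynomial of degree at most s in the components of ξ. Then 𝒞 is a VC class with VC dimension at most 2 N log₂(4 e s). -/
/-- A collection `𝒞` of subsets of `Z` shatters a finite set `S` if for every `B ⊆ S` there is
`A ∈ 𝒞` with `A ∩ S = B`. -/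
def Shatters {Z : Type*} (𝒞 : Set (Set Z)) (S : Finset Z) : Prop :=
  ∀ B ⊆ S, ∃ A ∈ 𝒞, ∀ z ∈ S, z ∈ A ↔ z ∈ B

open MvPolynomial in
lemma aux_mem_span {N D : ℕ} (r : Fin N → MvPolynomial (Fin N) ℝ)
    (hr : ∀ j, (r j).totalDegree < D) (Z : Finset (Fin N → ℝ))
    (hZ : ∀ z ∈ Z, ∀ j, z j ^ D = eval z (r j)) (n : ℕ) :
    ∀ p : MvPolynomial (Fin N) ℝ, p.totalDegree < n →
      (fun z : Z => eval (z : Fin N → ℝ) p) ∈ Submodule.span ℝ (Set.range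
        (fun a : Fin N → Fin D => fun z : Z => ∏ j, (z : Fin N → ℝ) j ^ (a j : ℕ))) := by
  induction n with
  | zero => intro p hp; omega
  | succ n ih =>
    intro p hp
    have key : ∀ a ∈ p.support, (fun z : Z => eval (z : Fin N → ℝ) (monomial a (coeff a p))) ∈
        Submodule.span ℝ (Set.range
        (fun a : Fin N → Fin D => fun z : Z => ∏ j, (z : Fin N → ℝ) j ^ (a j : ℕ))) := by
      intro a ha
      by_cases h : ∀ j, a j < D
      · have : (fun z : Z => eval (z : Fin N → ℝ) (monomial a (coeff a p))) =
          (coeff a p) • (fun z : Z => ∏ j, (z : Fin N → ℝ) j ^ (a j : ℕ)) := by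
          funext z
          simp [eval_monomial, Finsupp.prod_fintype]
        rw [this]
        exact Submodule.smul_mem _ _ (Submodule.subset_span ⟨fun j => ⟨a j, h j⟩, rfl⟩)
      · push Not at h
        obtain ⟨j, hj⟩ := h
        set b : Fin N →₀ ℕ := a - Finsupp.single j D with hb
        have hab : a = b + Finsupp.single j D := by
          rw [hb, tsub_add_cancel_of_le]
          simpa using hj
        have : (fun z : Z => eval (z : Fin N → ℝ) (monomial a (coeff a p))) =
          (fun z : Z => eval (z : Fin N → ℝ) (monomial b (coeff a p) * r j)) := by
          funext z
          rw [map_mul, ← hZ z z.2 j]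
          conv_lhs => rw [hab, ← mul_one (coeff _ p), ← monomial_mul]
          rw [← hab, map_mul]
          congr 1
          simp only [eval_monomial, one_mul]
          rw [Finsupp.prod_single_index (by simp)]
        rw [this]
        apply ih
        have h1 := le_totalDegree ha
        have h2 := totalDegree_mul (monomial b (coeff a p)) (r j)
        have h3 := totalDegree_monomial_le b (coeff a p)
        have h4 : (a.sum fun _ e => e) = (b.sum fun _ e => e) + D := by
          conv_lhs => rw [hab]
          rw [Finsupp.sum_add_index'] <;> simp
        have h5 := hr j
        have h6 : (b.sum fun _ => id) = (b.sum fun _ e => e) := rfl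
        rw [h6] at h3
        omega
    have : (fun z : Z => eval (z : Fin N → ℝ) p) =
        ∑ a ∈ p.support, (fun z : Z => eval (z : Fin N → ℝ) (monomial a (coeff a p))) := by
      funext z
      conv_lhs => rw [p.as_sum]
      rw [map_sum, Finset.sum_apply]
    rw [this]
    exact Submodule.sum_mem _ key

open MvPolynomial in
lemma card_zeros_le {N D : ℕ} (r : Fin N → MvPolynomial (Fin N) ℝ)
    (hr : ∀ j, (r j).totalDegree < D) (Z : Finset (Fin N → ℝ))
    (hZ : ∀ z ∈ Z, ∀ j, z j ^ D = eval z (r j)) : Z.card ≤ D ^ N := by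
  classical
  have htop : Submodule.span ℝ (Set.range
        (fun a : Fin N → Fin D => fun z : Z => ∏ j, (z : Fin N → ℝ) j ^ (a j : ℕ))) = ⊤ := by
    rw [eq_top_iff, ← (Pi.basisFun ℝ Z).span_eq, Submodule.span_le]
    rintro _ ⟨v, rfl⟩
    set q : MvPolynomial (Fin N) ℝ := ∏ w ∈ Z.erase v, ∑ j, (X j - C (w j)) ^ 2 with hq
    have h0 : eval (v : Fin N → ℝ) q ≠ 0 := by
      rw [hq, map_prod, Finset.prod_ne_zero_iff]
      intro w hw h
      simp only [map_sum, map_pow, map_sub, eval_X, eval_C] at h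
      rw [Finset.sum_eq_zero_iff_of_nonneg (fun _ _ => sq_nonneg _)] at h
      apply (Finset.mem_erase.1 hw).1
      funext j
      have := h j (Finset.mem_univ _)
      have := pow_eq_zero_iff (two_ne_zero) |>.1 this
      linarith
    have := aux_mem_span r hr Z hZ _ q (Nat.lt_succ_self _)
    have h2 := Submodule.smul_mem _ (eval (v : Fin N → ℝ) q)⁻¹ this
    rw [SetLike.mem_coe]
    convert h2 using 1
    funext z
    by_cases hzv : z = v
    · subst hzv; simp [h0]
    · have : eval (z : Fin N → ℝ) q = 0 := by
        rw [hq, map_prod]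
        apply Finset.prod_eq_zero (i := (z : Fin N → ℝ))
        · simp [Subtype.coe_injective.ne_iff, hzv]
        · simp
      simp [this, hzv]
  have h1 := finrank_range_le_card (R := ℝ) (fun a : Fin N → Fin D => fun z : Z => ∏ j, (z : Fin N → ℝ) j ^ (a j : ℕ))
  rw [Set.finrank, htop, finrank_top] at h1
  simpa using h1

open MvPolynomial in
lemma totalDegree_pderiv_le' {N : ℕ} (p : MvPolynomial (Fin N) ℝ) (j : Fin N) :
    (pderiv j p).totalDegree ≤ p.totalDegree := by
  conv_lhs => rw [p.as_sum, map_sum]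
  apply totalDegree_finsetSum_le
  intro a ha
  rw [pderiv_monomial]
  refine (totalDegree_monomial_le _ _).trans ?_
  refine le_trans ?_ (le_totalDegree ha)
  have : a - Finsupp.single j 1 ≤ a := tsub_le_self
  have := Finsupp.degree_mono this
  exact this

open MvPolynomial in
lemma hasDerivAt_eval_update {N : ℕ} (p : MvPolynomial (Fin N) ℝ) (j : Fin N) (x : Fin N → ℝ)
    (t : ℝ) : HasDerivAt (fun t => eval (Function.update x j t) p)
      (eval (Function.update x j t) (pderiv j p)) t := by
  classical
  induction p using MvPolynomial.induction_on with
  | C a => simpa using hasDerivAt_const t a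
  | add p q hp hq => simp only [map_add]; exact hp.add hq
  | mul_X p i hp =>
    have : HasDerivAt (fun t => Function.update x j t i) (if i = j then 1 else 0) t := by
      by_cases h : i = j
      · subst h; simpa using hasDerivAt_id' t
      · simpa [h] using hasDerivAt_const t (x i)
    have := hp.mul this
    simp only [map_mul, eval_X, Derivation.leibniz, pderiv_X, smul_eq_mul, map_add]
    refine this.congr_deriv ?_
    by_cases h : i = j
    · subst h; simp; ring
    · simp [h]; ring

open MvPolynomial in
lemma pderiv_eq_zero_of_isLocalMin {N : ℕ} (p : MvPolynomial (Fin N) ℝ) (j : Fin N)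
    (x : Fin N → ℝ) (h : IsLocalMin (fun x => eval x p) x) : eval x (pderiv j p) = 0 := by
  have h1 := hasDerivAt_eval_update p j x (x j)
  have hc : ContinuousAt (fun t => Function.update x j t) (x j) := by fun_prop
  have h2 : IsLocalMin (fun t => eval (Function.update x j t) p) (x j) := by
    have hx : Function.update x j (x j) = x := Function.update_eq_self j x
    have : Filter.Tendsto (fun t => Function.update x j t) (nhds (x j)) (nhds x) := by
      have := hc.tendsto; rwa [hx] at this
    have h3 := this.eventually h
    simpa [IsLocalMin, IsMinFilter, hx] using h3
  have := h2.hasDerivAt_eq_zero h1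
  simpa using this
open MvPolynomial in
lemma generic_shift {ι : Type} [Fintype ι] [DecidableEq ι] {N : ℕ} (f : ι → MvPolynomial (Fin N) ℝ)
    (δ : ℝ) (hδ : 0 < δ) : ∃ ε : ι → ℝ, (∀ i, 0 < ε i ∧ ε i < δ) ∧
      ∀ x, (Finset.univ.filter (fun i => eval x (f i) = ε i)).card ≤ N := by
  have hrel : ∀ I : Finset ι, N < I.card → ∃ q : MvPolynomial I ℝ, q ≠ 0 ∧
      aeval (fun i : I => f i) q = 0 := by
    intro I hI
    by_contra hcon
    push Not at hcon
    have hai : AlgebraicIndependent ℝ (fun i : I => f i) := by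
      rw [algebraicIndependent_iff]
      intro p hp
      by_contra h
      exact hcon p h hp
    have h1 := hai.lift_cardinalMk_le_trdeg
    rw [MvPolynomial.trdeg_of_isDomain] at h1
    simp at h1
    omega
  choose! q hq0 hq using hrel
  set P : MvPolynomial ι ℝ := ∏ I ∈ Finset.univ.filter (fun I : Finset ι => N < I.card),
    rename (fun i : I => (i : ι)) (q I) with hP
  have hP0 : P ≠ 0 := by
    rw [hP, Finset.prod_ne_zero_iff]
    intro I hI h
    apply hq0 I (Finset.mem_filter.1 hI).2
    apply rename_injective (fun i : I => (i : ι)) Subtype.coe_injective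
    rw [h, map_zero]
  have : ∃ ε ∈ Set.pi Set.univ (fun _ : ι => Set.Ioo 0 δ), eval ε P ≠ 0 := by
    by_contra hcon
    push Not at hcon
    apply hP0
    apply funext_set (fun _ : ι => Set.Ioo 0 δ) (fun _ => Set.Ioo_infinite hδ)
    intro x hx
    rw [hcon x hx, map_zero]
  obtain ⟨ε, hε, hne⟩ := this
  refine ⟨ε, fun i => hε i trivial, fun x => ?_⟩
  by_contra hcon
  push Not at hcon
  set I := Finset.univ.filter (fun i => eval x (f i) = ε i) with hI
  apply hne
  rw [hP, map_prod]
  apply Finset.prod_eq_zero (i := I) (by simpa using hcon)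
  rw [eval_rename]
  have h2 := congrArg (eval x) (hq I hcon)
  rw [map_zero] at h2
  rw [← h2]
  have : (ε ∘ fun i : I => (i : ι)) = fun i : I => eval x (f i) := by
    funext i
    exact ((Finset.mem_filter.1 i.2).2).symm
  rw [this]
  rw [aeval_def, ← coe_eval₂Hom]
  simp only [← RingHom.comp_apply]
  congr 1
  apply MvPolynomial.ringHom_ext <;> simp
lemma numeric_final (m N s : ℕ) (hN : 1 ≤ N) (hs : 1 ≤ s) 
   (h : (2:ℝ)^m ≤ ((2*s+1)^N : ℕ) * ∑ I ∈ Finset.univ.filter (fun I : Finset (Fin m) => I.card ≤ N), (2:ℝ)^I.card) :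
   (m : ℝ) ≤ 2 * N * Real.logb 2 (4 * Real.exp 1 * s) := by
  by_contra hcon
  push Not at hcon
  have hNr : (1:ℝ) ≤ N := by exact_mod_cast hN
  have hsr : (1:ℝ) ≤ s := by exact_mod_cast hs
  have he : (2.7182818283:ℝ) < Real.exp 1 := Real.exp_one_gt_d9
  set L := Real.logb 2 (4 * Real.exp 1 * s) with hL
  have hu : (0:ℝ) < 4 * Real.exp 1 * s := by positivity
  have hLu : (2:ℝ) ^ L = 4 * Real.exp 1 * s := by
    rw [hL]; exact Real.rpow_logb (by norm_num) (by norm_num) hu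
  have h34 : (10.2:ℝ) ≤ (2:ℝ)^(3.4:ℝ) := by
    have : ((2:ℝ)^(3.4:ℝ))^5 = 2^17 := by
      rw [← Real.rpow_natCast, ← Real.rpow_mul (by norm_num)]; norm_num
    apply le_of_pow_le_pow_left₀ (n := 5) (by norm_num) (by positivity)
    rw [this]; norm_num
  have h34' : (2:ℝ)^(3.4:ℝ) ≤ 10.8 := by
    have : ((2:ℝ)^(3.4:ℝ))^5 = 2^17 := by
      rw [← Real.rpow_natCast, ← Real.rpow_mul (by norm_num)]; norm_num
    apply le_of_pow_le_pow_left₀ (n := 5) (by norm_num) (by positivity)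
    rw [this]; norm_num
  have hL34 : 3.4 ≤ L := by
    rw [hL, Real.le_logb_iff_rpow_le (by norm_num) hu]
    nlinarith
  set x : ℝ := m / N with hx
  have hmx : (m:ℝ) = x * N := by rw [hx]; field_simp
  have hxL : 2 * L < x := by
    rw [hx, lt_div_iff₀ (by linarith)]; linarith
  have hx0 : 0 < x := by linarith
  have hm0 : (0:ℝ) < m := by rw [hmx]; positivity
  -- sum bound
  set y : ℝ := N / (2 * m) with hy
  have hy0 : 0 < y := by positivity
  have hy1 : y ≤ 1 := by
    rw [hy, div_le_one (by positivity), hmx]; nlinarith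
  have hsum : ∑ I ∈ Finset.univ.filter (fun I : Finset (Fin m) => I.card ≤ N), (2:ℝ)^I.card
      ≤ (y⁻¹)^N * (1 + 2*y)^m := by
    have h1 : (1 + 2*y)^m = ∑ I : Finset (Fin m), (2*y)^I.card := by
      have := Fintype.sum_pow_mul_eq_add_pow (Fin m) (2*y) 1
      simp at this
      rw [this, add_comm]
    rw [h1, Finset.mul_sum]
    refine le_trans (Finset.sum_le_sum (f := fun I => (2:ℝ)^I.card) (g := fun I : Finset (Fin m) => (y⁻¹)^N * (2*y)^I.card) ?_) 
      (Finset.sum_le_sum_of_subset_of_nonneg (Finset.filter_subset _ _) (fun _ _ _ => by positivity))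
    intro I hI
    have hc := (Finset.mem_filter.1 hI).2
    rw [mul_pow, inv_pow]
    have : y^N ≤ y^I.card := pow_le_pow_of_le_one hy0.le hy1 hc
    have h3 : 1 ≤ (y^N)⁻¹ * y^I.card := by
      rw [inv_mul_eq_div, one_le_div (by positivity)]; exact this
    have h4 : (0:ℝ) < 2^I.card := by positivity
    show (2:ℝ)^I.card ≤ (y^N)⁻¹ * (2^I.card * y^I.card)
    nlinarith
  have hexp : (1+2*y)^m ≤ (Real.exp 1)^N := by
    have : 1 + 2*y ≤ Real.exp (2*y) := by have := Real.add_one_le_exp (2*y); linarith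
    calc (1+2*y)^m ≤ (Real.exp (2*y))^m := by gcongr
      _ = Real.exp 1 ^ N := by
        rw [← Real.exp_nat_mul, ← Real.exp_nat_mul]
        congr 1; rw [hy]; field_simp
  have hyi : y⁻¹ = 2 * x := by rw [hy, hx]; field_simp
  have hmain : ((2:ℝ)^x)^N ≤ (6 * Real.exp 1 * s * x)^N := by
    calc ((2:ℝ)^x)^N = 2^m := by
          rw [← Real.rpow_natCast, ← Real.rpow_mul (by norm_num), ← hmx, Real.rpow_natCast]
      _ ≤ _ := h
      _ ≤ (3 * s)^N * ((y⁻¹)^N * Real.exp 1 ^ N) := by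
          have hc : (((2*s+1)^N : ℕ) : ℝ) = (2*(s:ℝ)+1)^N := by
            rw [Nat.cast_pow, Nat.cast_add, Nat.cast_mul]; norm_num
          rw [hc]
          refine mul_le_mul ?_ ?_ (Finset.sum_nonneg (fun _ _ => by positivity)) (by positivity)
          · exact pow_le_pow_left₀ (by positivity) (by linarith) _
          · exact hsum.trans (by gcongr)
      _ = _ := by rw [hyi, ← mul_pow, ← mul_pow]; congr 1; ring
  have hmain2 : (2:ℝ)^x ≤ 6 * Real.exp 1 * s * x :=
    le_of_pow_le_pow_left₀ (by omega) (by positivity) hmain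
  -- contradiction
  set w := x/2 with hw
  have hwL : L < w := by rw [hw]; linarith
  have hxw : (2:ℝ)^x = 2^w * 2^w := by
    rw [← Real.rpow_add (by norm_num)]; congr 1; rw [hw]; ring
  have hwu : 4 * Real.exp 1 * s < 2^w := by
    rw [← hLu]; exact Real.rpow_lt_rpow_of_exponent_lt (by norm_num) hwL
  have hw3 : 3 * w < 2^w := by
    have h1 : (2:ℝ)^w = 2^(3.4:ℝ) * 2^(w-3.4) := by
      rw [← Real.rpow_add (by norm_num)]; congr 1; ring
    have h2 : 1 + (w-3.4) * Real.log 2 ≤ (2:ℝ)^(w-3.4) := by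
      rw [Real.rpow_def_of_pos (by norm_num)]
      have := Real.add_one_le_exp (Real.log 2 * (w-3.4)); linarith
    have h3 : (0.69:ℝ) < Real.log 2 := by have := Real.log_two_gt_d9; linarith
    have h5 : 1 + (w-3.4) * 0.69 ≤ (2:ℝ)^(w-3.4) := by nlinarith
    rw [h1]; nlinarith
  have hxw2 : x = 2 * w := by rw [hw]; ring
  rw [hxw, hxw2] at hmain2
  have hw0 : 0 < w := by linarith
  nlinarith [mul_lt_mul hwu hw3.le (by positivity) (by positivity)]

open MvPolynomial in
lemma card_clopen_le {κ : Type} [Fintype κ] {N s : ℕ} (F : MvPolynomial (Fin N) ℝ)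
    (hF : F.totalDegree ≤ 2 * s) (hF0 : ∀ x, 0 ≤ eval x F)
    (K O : κ → Set (Fin N → ℝ)) (hK : ∀ k, IsClosed (K k)) (hO : ∀ k, IsOpen (O k))
    (hOK : ∀ k, O k ⊆ K k) (hdisj : ∀ k l x, x ∈ O k → x ∈ O l → k = l)
    (hne : ∀ k, ∃ p ∈ K k, eval p F = 0)
    (hKO : ∀ k, ∀ x ∈ K k, eval x F = 0 → x ∈ O k) :
    Fintype.card κ ≤ (2 * s + 1) ^ N := by
  classical
  choose p hpK hpF using hne
  set H : MvPolynomial (Fin N) ℝ := ∑ j, X j ^ (2 * s + 2) with hH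
  have hHe : ∀ x, eval x H = ∑ j, x j ^ (2 * s + 2) := by intro x; simp [hH]
  have hev : Even (2 * s + 2) := ⟨s + 1, by ring⟩
  have hH0 : ∀ x, 0 ≤ eval x H := fun x => by
    rw [hHe]; exact Finset.sum_nonneg fun j _ => hev.pow_nonneg _
  have hcF : Continuous fun x => eval x F := MvPolynomial.continuous_eval F
  have hcH : Continuous fun x => eval x H := MvPolynomial.continuous_eval H
  obtain ⟨c, hc⟩ : ∃ c, ∀ k, eval (p k) H < c := by
    obtain ⟨M, hM⟩ := (Set.finite_range (fun k => eval (p k) H)).bddAbove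
    exact ⟨M + 1, fun k => lt_of_le_of_lt (hM ⟨k, rfl⟩) (by linarith)⟩
  have hcomp : IsCompact {x : Fin N → ℝ | eval x H ≤ c} := by
    have hsub : {x : Fin N → ℝ | eval x H ≤ c} ⊆ Metric.closedBall 0 (max 1 c) := by
      intro x hx
      have hx' : eval x H ≤ c := hx
      rw [mem_closedBall_zero_iff, pi_norm_le_iff_of_nonneg (by positivity)]
      intro j
      rw [Real.norm_eq_abs]
      by_contra hcon
      push Not at hcon
      have h1 : 1 < |x j| := lt_of_le_of_lt (le_max_left _ _) hcon
      have h2 : c < |x j| := lt_of_le_of_lt (le_max_right _ _) hcon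
      have h3 : |x j| ≤ |x j| ^ (2 * s + 2) := le_self_pow₀ h1.le (by omega)
      have h4 : x j ^ (2 * s + 2) ≤ eval x H := by
        rw [hHe]
        exact Finset.single_le_sum (f := fun j => x j ^ (2 * s + 2))
          (fun j _ => hev.pow_nonneg _) (Finset.mem_univ j)
      rw [hev.pow_abs] at h3
      linarith
    exact (isCompact_closedBall _ _).of_isClosed_subset (isClosed_le hcH continuous_const) hsub
  have hmu : ∀ k, ∃ μ : ℝ, 0 < μ ∧ ∀ x ∈ K k, eval x H ≤ c → x ∉ O k → μ ≤ eval x F := by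
    intro k
    have hE : IsCompact ({x : Fin N → ℝ | eval x H ≤ c} ∩ (K k ∩ (O k)ᶜ)) :=
      hcomp.inter_right ((hK k).inter (hO k).isClosed_compl)
    rcases Set.eq_empty_or_nonempty ({x : Fin N → ℝ | eval x H ≤ c} ∩ (K k ∩ (O k)ᶜ)) with h | h
    · refine ⟨1, one_pos, fun x h1 h2 h3 => ?_⟩
      have : x ∈ ({x : Fin N → ℝ | eval x H ≤ c} ∩ (K k ∩ (O k)ᶜ)) := ⟨h2, h1, h3⟩
      rw [h] at this
      exact this.elim
    · obtain ⟨y, hy, hmin⟩ := hE.exists_isMinOn h hcF.continuousOn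
      refine ⟨eval y F, ?_, fun x h1 h2 h3 => hmin ⟨h2, h1, h3⟩⟩
      refine lt_of_le_of_ne (hF0 y) (fun h0 => ?_)
      exact hy.2.2 (hKO k y hy.2.1 h0.symm)
  choose μ hμ0 hμ using hmu
  obtain ⟨ν, hν0, hν⟩ : ∃ ν : ℝ, 0 < ν ∧ ∀ k, ν ≤ μ k := by
    rcases isEmpty_or_nonempty κ with h | h
    · exact ⟨1, one_pos, fun k => (h.false k).elim⟩
    · obtain ⟨k0, hk0⟩ := Finite.exists_min μ
      exact ⟨μ k0, hμ0 k0, hk0⟩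
  set τ : ℝ := ν / (2 * (|c| + 1)) with hτ
  have hτ0 : 0 < τ := by positivity
  have hτc : τ * c < ν := by
    have h1 : τ * (|c| + 1) = ν / 2 := by rw [hτ]; field_simp
    have h2 : c ≤ |c| := le_abs_self c
    nlinarith
  set G : MvPolynomial (Fin N) ℝ := F + C τ * H with hG
  have hGe : ∀ x, eval x G = eval x F + τ * eval x H := by intro x; simp [hG]
  have hcG : Continuous fun x => eval x G := MvPolynomial.continuous_eval G
  have hex : ∀ k, ∃ x ∈ O k, IsLocalMin (fun x => eval x G) x := by
    intro k
    obtain ⟨x, hx, hmin⟩ := (hcomp.inter_right (hK k)).exists_isMinOn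
      ⟨p k, (hc k).le, hpK k⟩ hcG.continuousOn
    have h1 : eval x G < τ * c := by
      have : eval x G ≤ eval (p k) G := hmin ⟨(hc k).le, hpK k⟩
      rw [hGe (p k), hpF k] at this
      nlinarith [hc k]
    have h1' := h1
    rw [hGe] at h1
    have hlt : eval x H < c := by
      have := hF0 x
      by_contra hcon
      push Not at hcon
      nlinarith
    have hxO : x ∈ O k := by
      by_contra hcon
      have h2 := hμ k x hx.2 hx.1 hcon
      have h3 := hν k
      have h4 := mul_nonneg hτ0.le (hH0 x)
      linarith
    refine ⟨x, hxO, ?_⟩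
    have hnb : ({x : Fin N → ℝ | eval x H ≤ c} ∩ K k) ∈ nhds x := by
      refine Filter.mem_of_superset
        (((isOpen_lt hcH continuous_const).inter (hO k)).mem_nhds ⟨hlt, hxO⟩) ?_
      rintro y ⟨hy1, hy2⟩
      exact ⟨show _ ≤ c from le_of_lt (show _ < c from hy1), hOK k hy2⟩
    exact hmin.isLocalMin hnb
  choose x hxO hxmin using hex
  have hinj : Function.Injective x := by
    intro k l hkl
    exact hdisj k l (x k) (hxO k) (hkl ▸ hxO l)
  set a : ℝ := τ * (2 * s + 2) with ha
  have ha0 : a ≠ 0 := by positivity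
  have := card_zeros_le (N := N) (D := 2 * s + 1) (fun j => C (-a⁻¹) * pderiv j F) (by
    intro j
    have h1 := totalDegree_mul (C (-a⁻¹)) (pderiv j F)
    have h2 := totalDegree_pderiv_le' F j
    rw [totalDegree_C] at h1
    omega) (Finset.univ.image x) (by
    intro z hz j
    obtain ⟨k, -, rfl⟩ := Finset.mem_image.1 hz
    have h := pderiv_eq_zero_of_isLocalMin G j (x k) (hxmin k)
    have hd : eval (x k) (pderiv j G) = eval (x k) (pderiv j F) + a * (x k j) ^ (2 * s + 1) := by
      rw [hG, map_add, map_add, pderiv_C_mul, hH, map_sum]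
      have : ∀ i ∈ Finset.univ, i ≠ j → pderiv j (X i ^ (2 * s + 2) : MvPolynomial (Fin N) ℝ) = 0 := by
        intro i _ hij
        rw [pderiv_pow, pderiv_X_of_ne hij, mul_zero]
      rw [Finset.sum_eq_single j this (by simp), pderiv_pow, pderiv_X_self]
      simp [ha]
      ring
    rw [hd] at h
    simp only [map_mul, eval_C]
    field_simp
    linarith)
  rwa [Finset.card_image_of_injective _ hinj, Finset.card_univ] at this

/-- the sign attached to membership in `B` -/
def sgB {ι : Type} [DecidableEq ι] (B : Finset ι) (i : ι) : ℝ := if i ∈ B then 1 else -1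

open MvPolynomial in
lemma pattern_count {ι : Type} [Fintype ι] [DecidableEq ι] {N s : ℕ}
    (f : ι → MvPolynomial (Fin N) ℝ) (hf : ∀ i, (f i).totalDegree ≤ s) (ε : ι → ℝ)
    (hε : ∀ x, (Finset.univ.filter (fun i => eval x (f i) = ε i)).card ≤ N)
    (hpat : ∀ B : Finset ι, ∃ x, ∀ i, 0 ≤ sgB B i * (eval x (f i) - ε i)) :
    2 ^ Fintype.card ι ≤ (2 * s + 1) ^ N *
      ∑ I ∈ Finset.univ.filter (fun I : Finset ι => I.card ≤ N), 2 ^ I.card := by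
  set act : (Fin N → ℝ) → Finset ι := fun x => Finset.univ.filter (fun i => eval x (f i) = ε i)
    with hact
  have hmax : ∀ B : Finset ι, ∃ x, (∀ i, 0 ≤ sgB B i * (eval x (f i) - ε i)) ∧
      ∀ y, (∀ i, 0 ≤ sgB B i * (eval y (f i) - ε i)) → (act y).card ≤ (act x).card := by
    intro B
    set T : Set ℕ := {n | ∃ x, (∀ i, 0 ≤ sgB B i * (eval x (f i) - ε i)) ∧ (act x).card = n} with hT
    have hTne : T.Nonempty := by
      obtain ⟨x, hx⟩ := hpat B
      exact ⟨_, x, hx, rfl⟩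
    have hTb : BddAbove T := ⟨N, by rintro _ ⟨x, -, rfl⟩; exact hε x⟩
    obtain ⟨x, hx, hxT⟩ := Nat.sSup_mem hTne hTb
    refine ⟨x, hx, fun y hy => ?_⟩
    rw [hxT]
    exact le_csSup hTb ⟨y, hy, rfl⟩
  choose x hx hxm using hmax
  have hcount := Finset.card_le_mul_card_image_of_maps_to (s := (Finset.univ : Finset (Finset ι)))
    (f := fun B => (⟨act (x B), B ∩ act (x B)⟩ : (_ : Finset ι) × Finset ι))
    (t := (Finset.univ.filter (fun I : Finset ι => I.card ≤ N)).sigma (fun I => I.powerset))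
    (by
      intro B _
      simp only [Finset.mem_sigma, Finset.mem_filter, Finset.mem_univ, true_and,
        Finset.mem_powerset]
      exact ⟨hε (x B), Finset.inter_subset_right⟩)
    ((2 * s + 1) ^ N) (by
      rintro ⟨I, J⟩ -
      set W := Finset.univ.filter (fun B : Finset ι =>
        (⟨act (x B), B ∩ act (x B)⟩ : (_ : Finset ι) × Finset ι) = ⟨I, J⟩) with hW
      have hWm : ∀ B : W, act (x B) = I ∧ (B : Finset ι) ∩ I = J := by
        rintro ⟨B, hB⟩
        have := (Finset.mem_filter.1 hB).2
        rw [Sigma.mk.injEq] at this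
        obtain ⟨h1, h2⟩ := this
        have h3 := eq_of_heq h2
        rw [h1] at h3
        exact ⟨h1, h3⟩
      rw [← Fintype.card_coe W]
      have hcont : ∀ i, Continuous fun y => eval y (f i) := fun i => MvPolynomial.continuous_eval _
      set F : MvPolynomial (Fin N) ℝ := ∑ i ∈ I, (f i - C (ε i)) ^ 2 with hF
      have hFe : ∀ y, eval y F = ∑ i ∈ I, (eval y (f i) - ε i) ^ 2 := by intro y; simp [hF]
      have hFz : ∀ y, eval y F = 0 ↔ ∀ i ∈ I, eval y (f i) = ε i := by
        intro y
        rw [hFe, Finset.sum_eq_zero_iff_of_nonneg (fun _ _ => sq_nonneg _)]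
        simp [sub_eq_zero]
      refine card_clopen_le (s := s) F ?_ ?_
        (fun B : W => {y | ∀ i, i ∉ I → 0 ≤ sgB (B : Finset ι) i * (eval y (f i) - ε i)})
        (fun B : W => {y | ∀ i, i ∉ I → 0 < sgB (B : Finset ι) i * (eval y (f i) - ε i)})
        ?_ ?_ ?_ ?_ ?_ ?_
      · apply totalDegree_finsetSum_le
        intro i _
        refine (totalDegree_pow _ _).trans ?_
        have := totalDegree_sub_C_le (f i) (ε i)
        have := hf i
        omega
      · intro y; rw [hFe]; exact Finset.sum_nonneg fun _ _ => sq_nonneg _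
      · intro B
        simp only [Set.ofPred_forall]
        refine isClosed_iInter fun i => isClosed_iInter fun _ => ?_
        exact isClosed_le continuous_const (continuous_const.mul ((hcont i).sub continuous_const))
      · intro B
        simp only [Set.ofPred_forall]
        refine isOpen_iInter_of_finite fun i => isOpen_iInter_of_finite fun _ => ?_
        exact isOpen_lt continuous_const (continuous_const.mul ((hcont i).sub continuous_const))
      · intro B y hy i hi
        exact (hy i hi).le
      · intro B B' y hy hy'
        apply Subtype.ext
        ext i
        by_cases hi : i ∈ I
        · have h1 := (hWm B).2.trans (hWm B').2.symm
          have h2 := Finset.ext_iff.1 h1 i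
          simpa [hi] using h2
        · have h1 := hy i hi
          have h2 := hy' i hi
          simp only [sgB] at h1 h2
          by_cases a : i ∈ (B : Finset ι) <;> by_cases b : i ∈ (B' : Finset ι) <;>
            simp only [a, b, if_true, if_false] at h1 h2 ⊢ <;> linarith
      · intro B
        refine ⟨x B, fun i _ => hx B i, ?_⟩
        rw [hFz]
        intro i hi
        rw [← (hWm B).1] at hi
        exact (Finset.mem_filter.1 hi).2
      · intro B y hy hy0 i hi
        rw [hFz] at hy0
        have hyC : ∀ i, 0 ≤ sgB (B : Finset ι) i * (eval y (f i) - ε i) := by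
          intro i
          by_cases h : i ∈ I
          · rw [hy0 i h]; simp
          · exact hy i h
        have hsub : I ⊆ act y := fun i hi => Finset.mem_filter.2 ⟨Finset.mem_univ _, hy0 i hi⟩
        have hle := hxm B y hyC
        rw [(hWm B).1] at hle
        have heq := Finset.eq_of_subset_of_card_le hsub hle
        refine lt_of_le_of_ne (hyC i) (fun h0 => hi ?_)
        rw [heq]
        refine Finset.mem_filter.2 ⟨Finset.mem_univ _, ?_⟩
        have hs0 : sgB (B : Finset ι) i ≠ 0 := by unfold sgB; split_ifs <;> norm_num
        have := (mul_eq_zero.1 h0.symm).resolve_left hs0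
        linarith)
  simpa [Finset.card_sigma] using hcount

/-- **VC dimension of positivity sets of polynomials.** Let `𝒞 = {A_ξ : ξ ∈ ℝ^N}` with
`A_ξ = { z ∈ ℝ^d : Π(z,ξ) > 0 }`, where for each `z` the map `ξ ↦ Π(z,ξ)` is a polynomial of
degree at most `s` in `ξ`. Then `𝒞` is a VC class with VC dimension at most
`2N log₂(4es)`: every finite set shattered by `𝒞` has cardinality at most `2N log₂(4es)`. -/
theorem stmt_8 {d : ℕ} (N s : ℕ) (hN : 1 ≤ N) (hs : 1 ≤ s)
    (Pz : (Fin d → ℝ) → MvPolynomial (Fin N) ℝ)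
    (hdeg : ∀ z, (Pz z).totalDegree ≤ s)
    (𝒞 : Set (Set (Fin d → ℝ)))
    (h𝒞 : 𝒞 = {A | ∃ ξ : Fin N → ℝ, A = {z | 0 < MvPolynomial.eval ξ (Pz z)}}) :
    ∀ S : Finset (Fin d → ℝ), Shatters 𝒞 S →
      (S.card : ℝ) ≤ 2 * N * Real.logb 2 (4 * Real.exp 1 * s) := by
  classical
  intro S hS
  set m := S.card with hm
  set e : Fin m ≃ S := S.equivFin.symm with he
  have hpat : ∀ B : Finset (Fin m), ∃ ξ : Fin N → ℝ,
      ∀ i, 0 < MvPolynomial.eval ξ (Pz (e i)) ↔ i ∈ B := by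
    intro B
    obtain ⟨A, hA, hAB⟩ := hS (B.image (fun i => (e i : Fin d → ℝ))) (by
      intro z hz
      obtain ⟨i, -, rfl⟩ := Finset.mem_image.1 hz
      exact (e i).2)
    rw [h𝒞] at hA
    obtain ⟨ξ, rfl⟩ := hA
    refine ⟨ξ, fun i => ?_⟩
    have := hAB (e i) (e i).2
    rw [Set.mem_setOf_eq] at this
    rw [this]
    simp [Subtype.coe_injective.eq_iff]
  choose ξ hξ using hpat
  obtain ⟨δ, hδ0, hδ⟩ : ∃ δ : ℝ, 0 < δ ∧ ∀ B : Finset (Fin m), ∀ i ∈ B,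
      δ ≤ MvPolynomial.eval (ξ B) (Pz (e i)) := by
    set g : Finset (Fin m) × Fin m → ℝ := fun q =>
      if q.2 ∈ q.1 then MvPolynomial.eval (ξ q.1) (Pz (e q.2)) else 1 with hg
    have hg0 : ∀ q, 0 < g q := by
      intro q
      simp only [hg]
      split_ifs with h
      · exact (hξ _ _).2 h
      · exact one_pos
    rcases isEmpty_or_nonempty (Fin m) with h | h
    · exact ⟨1, one_pos, fun B i => (h.false i).elim⟩
    · obtain ⟨q0, hq0⟩ := Finite.exists_min g
      refine ⟨g q0, hg0 q0, fun B i hi => ?_⟩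
      have := hq0 (B, i)
      simpa [hg, hi] using this
  obtain ⟨ε, hε, hgen⟩ := generic_shift (fun i : Fin m => Pz (e i)) δ hδ0
  have hc := pattern_count (s := s) (fun i : Fin m => Pz (e i)) (fun i => hdeg _) ε hgen (by
    intro B
    refine ⟨ξ B, fun i => ?_⟩
    unfold sgB
    split_ifs with h
    · have := hδ B i h
      have := (hε i).2
      linarith
    · have h1 := mt (hξ B i).1 h
      have := (hε i).1
      linarith)
  apply numeric_final m N s hN hs
  rw [Fintype.card_fin] at hc
  exact_mod_cast hc
end

section
/- Let Z be a set, Λ ⊆ ℝ^N, s ≥ 1, and let { p_θ : θ ∈ Λ } be a family of real-valued functions on Z such that for every z ∈ Z the map θ ↦ p_θ(z) is the restriction to Λ of a polynomial of degree at most s on ℝ^N. Then the Yatracos class 𝒜 = { { z ∈ Z : p_θ(z) > p_{θ'}(z) } : θ, θ' ∈ Λ, θ ≠ θ' } is a VC class with VC dimension at most 4 N log₂(4 e s). -/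
open MvPolynomial in
lemma yat_bezout {κ : Type*} [Fintype κ] (n : ℕ) (c : ℝ) (hc : c ≠ 0)
    (r : κ → MvPolynomial κ ℝ) (hr : ∀ j, (r j).totalDegree < n) (P : Finset (κ → ℝ))
    (hP : ∀ x ∈ P, ∀ j, c * x j ^ n + eval x (r j) = 0) :
    P.card ≤ n ^ Fintype.card κ := by
  classical
  let E : MvPolynomial κ ℝ →ₗ[ℝ] (P → ℝ) :=
    LinearMap.pi fun x => (aeval (R := ℝ) (x : κ → ℝ)).toLinearMap
  have hE : ∀ p (x : P), E p x = eval (x : κ → ℝ) p := fun p x => by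
    simp [E, aeval_eq_eval]
  let b : (κ → Fin n) → (P → ℝ) := fun a x => ∏ j, (x : κ → ℝ) j ^ (a j : ℕ)
  let W := Submodule.span ℝ (Set.range b)
  have key : ∀ d : ℕ, ∀ p : MvPolynomial κ ℝ, p.totalDegree < d → E p ∈ W := by
    intro d
    induction d with
    | zero => intro p hp; omega
    | succ d ih =>
      intro p hp
      rw [p.as_sum, map_sum]
      refine Submodule.sum_mem _ fun a ha => ?_
      have hdeg : a.degree ≤ d := by
        have := le_totalDegree ha
        rw [Finsupp.degree_eq_sum]
        rw [Finsupp.sum_fintype _ _ (by simp)] at this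
        omega
      by_cases hlt : ∀ j, a j < n
      · have : E (monomial a (coeff a p)) = (coeff a p) • b (fun j => ⟨a j, hlt j⟩) := by
          funext x
          rw [hE, eval_monomial, Finsupp.prod_fintype _ _ (by simp)]
          simp [b]
        rw [this]
        exact Submodule.smul_mem _ _ (Submodule.subset_span ⟨_, rfl⟩)
      · push Not at hlt
        obtain ⟨j, hj⟩ := hlt
        have hle : Finsupp.single j n ≤ a := by simpa using hj
        have hsplit : a = (a - Finsupp.single j n) + Finsupp.single j n :=
          (tsub_add_cancel_of_le hle).symm
        set a' := a - Finsupp.single j n with ha'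
        have hd' : a.degree = a'.degree + n := by
          rw [hsplit]; simp
        have heq : E (monomial a (coeff a p)) =
            E (monomial a' (-(c⁻¹) * coeff a p) * r j) := by
          funext x
          rw [hE, hE, map_mul]
          have h1 : monomial a (coeff a p) = monomial a' (coeff a p) * X j ^ n := by
            rw [X_pow_eq_monomial, monomial_mul, ← hsplit, mul_one]
          have h2 : monomial a' (-(c⁻¹) * coeff a p) = C (-(c⁻¹)) * monomial a' (coeff a p) := by
            rw [C_mul_monomial]
          rw [h1, h2, map_mul, map_mul, map_pow, eval_X, eval_C]
          have h3 := hP x x.2 j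
          have h4 : (x : κ → ℝ) j ^ n = -(c⁻¹) * eval (x : κ → ℝ) (r j) := by
            field_simp
            linarith
          rw [h4]; ring
        rw [heq]
        apply ih
        refine lt_of_le_of_lt (totalDegree_mul _ _) ?_
        have h5 := totalDegree_monomial_le (R := ℝ) a' (-(c⁻¹) * coeff a p)
        have h6 : (a'.sum fun _ e => e) = a'.degree := by
          rw [Finsupp.degree_eq_sum, Finsupp.sum_fintype _ _ (by simp)]
        have := hr j
        rw [Finsupp.sum] at h6
        simp only [Finsupp.sum, id] at h5
        omega
  have htop : W = ⊤ := by
    rw [eq_top_iff]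
    intro g _
    have hsep : ∀ x y : P, ∃ l : MvPolynomial κ ℝ, x ≠ y →
        eval (x : κ → ℝ) l = 1 ∧ eval (y : κ → ℝ) l = 0 := by
      intro x y
      by_cases hxy : x = y
      · exact ⟨0, fun h => absurd hxy h⟩
      · have : (x : κ → ℝ) ≠ y := fun h => hxy (Subtype.ext h)
        obtain ⟨j, hj⟩ := Function.ne_iff.1 this
        refine ⟨C (((x : κ → ℝ) j - (y : κ → ℝ) j)⁻¹) * (X j - C ((y : κ → ℝ) j)), fun _ => ?_⟩
        have := sub_ne_zero.2 hj
        constructor <;> simp [this]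
    choose l hl using hsep
    have : g = E (∑ x : P, C (g x) * ∏ y ∈ Finset.univ.erase x, l x y) := by
      funext z
      rw [hE, map_sum, Finset.sum_eq_single z]
      · rw [map_mul, eval_C, map_prod, Finset.prod_eq_one, mul_one]
        intro y hy
        exact (hl z y (Finset.ne_of_mem_erase hy).symm).1
      · intro x _ hxz
        rw [map_mul, map_prod, Finset.prod_eq_zero (i := z), mul_zero]
        · simp [hxz.symm]
        · exact (hl x z hxz).2
      · simp
    rw [this]
    exact key _ _ (Nat.lt_succ_self _)
  have h1 : Module.finrank ℝ W ≤ Fintype.card (κ → Fin n) := finrank_range_le_card b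
  rw [htop, finrank_top] at h1
  simpa using h1

open MvPolynomial in
lemma yat_totalDegree_pderiv {κ : Type*} (p : MvPolynomial κ ℝ) (j : κ) :
    (pderiv j p).totalDegree ≤ p.totalDegree := by
  classical
  rw [totalDegree]
  refine Finset.sup_le fun a ha => ?_
  have hmem : a + Finsupp.single j 1 ∈ p.support := by
    rw [mem_support_iff] at ha ⊢
    intro h0
    apply ha
    rw [coeff_pderiv, h0]
    simp
  have h1 := le_totalDegree hmem
  rw [Finsupp.sum_add_index' (by simp) (by simp)] at h1
  omega

open MvPolynomial in
lemma yat_hasDerivAt {κ : Type*} [Fintype κ] [DecidableEq κ] (p : MvPolynomial κ ℝ) (x : κ → ℝ)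
    (j : κ) :
    HasDerivAt (fun t : ℝ => eval (x + t • Pi.single j (1 : ℝ)) p) (eval x (pderiv j p)) 0 := by
  induction p using MvPolynomial.induction_on with
  | C a => simpa using hasDerivAt_const (0 : ℝ) a
  | add p q hp hq => 
    simp only [map_add]
    exact hp.add hq
  | mul_X p i hp =>
    have h : HasDerivAt (fun t : ℝ => eval (x + t • Pi.single j (1 : ℝ)) (X i : MvPolynomial κ ℝ))
        ((Pi.single j (1 : ℝ) : κ → ℝ) i) 0 := by
      simpa using ((hasDerivAt_id (0 : ℝ)).mul_const
        ((Pi.single j (1 : ℝ) : κ → ℝ) i)).const_add (x i)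
    have h2 := hp.mul h
    simp only [map_mul]
    refine h2.congr_deriv ?_
    simp only [pderiv_mul, pderiv_X, map_add, map_mul, eval_X, zero_smul, add_zero]
    by_cases hij : i = j
    · subst hij; simp
    · simp [hij]

open MvPolynomial in
lemma yat_genpos {ι κ : Type*} [Fintype ι] [Fintype κ]
    (h : ι → MvPolynomial κ ℝ) (b : ℝ) (hb : 0 < b) :
    ∃ e : ι → ℝ, (∀ i, 0 < e i ∧ e i < b) ∧ ∀ J : Finset ι, Fintype.card κ < J.card →
      ¬ ∃ x : κ → ℝ, ∀ i ∈ J, eval x (h i) = e i := by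
  classical
  have hA : ∀ J : Finset ι, ∃ A : MvPolynomial ι ℝ, A ≠ 0 ∧ (Fintype.card κ < J.card →
      ∀ x : κ → ℝ, ∀ e : ι → ℝ, (∀ i ∈ J, eval x (h i) = e i) → eval e A = 0) := by
    intro J
    by_cases hJ : Fintype.card κ < J.card
    · have hdep : ¬ AlgebraicIndependent ℝ (fun i : J => h i) := by
        intro hi
        have := hi.lift_cardinalMk_le_trdeg
        rw [MvPolynomial.trdeg_of_isDomain] at this
        simp at this
        omega
      rw [algebraicIndependent_iff] at hdep
      push Not at hdep
      obtain ⟨A, hA0, hA⟩ := hdep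
      refine ⟨rename Subtype.val A, ?_, ?_⟩
      · intro h0
        exact hA ((rename_injective _ Subtype.val_injective) (by simpa using h0))
      · intro _ x e he
        rw [eval_rename]
        have h1 := congrArg (eval x) hA0
        rw [map_zero] at h1
        rw [← h1]
        have : (e ∘ Subtype.val : J → ℝ) = fun i : J => eval x (h i) := by
          funext i; simp [he i i.2]
        rw [this]
        have h2 := eval₂_comp_left (eval x) (algebraMap ℝ (MvPolynomial κ ℝ)) (fun i : J => h i) A
        rw [aeval_def, h2, ← eval₂_id]
        congr 1
        ext; simp
    · exact ⟨1, one_ne_zero, fun h => absurd h hJ⟩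
  choose A hA0 hA using hA
  have hprod : ∏ J, A J ≠ 0 := Finset.prod_ne_zero_iff.2 fun J _ => hA0 J
  obtain ⟨e, he, hne⟩ : ∃ e ∈ Set.pi Set.univ (fun _ : ι => Set.Ioo 0 b), eval e (∏ J, A J) ≠ 0 := by
    by_contra hcon
    push Not at hcon
    exact hprod (funext_set (fun _ => Set.Ioo 0 b) (fun _ => Set.Ioo_infinite hb) (by simpa using hcon))
  refine ⟨e, fun i => he i trivial, fun J hJ ⟨x, hx⟩ => hne ?_⟩
  rw [map_prod]
  exact Finset.prod_eq_zero (Finset.mem_univ J) (hA J hJ x e hx)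
/-- The sign vector attached to a subset. -/
noncomputable def yatSg {ι : Type*} (B : Finset ι) (i : ι) : ℝ :=
  open Classical in if i ∈ B then 1 else -1

lemma yat_compact {κ : Type*} [Fintype κ] (D : ℕ) (hD : Even D) (hD0 : D ≠ 0) (c : ℝ) :
    IsCompact {x : κ → ℝ | ∑ j, x j ^ D ≤ c} := by
  have hclosed : IsClosed {x : κ → ℝ | ∑ j, x j ^ D ≤ c} :=
    isClosed_le (by fun_prop) continuous_const
  refine IsCompact.of_isClosed_subset
    (isCompact_Icc (a := fun _ : κ => -(max 1 c)) (b := fun _ : κ => max 1 c)) hclosed ?_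
  intro x hx
  have hj : ∀ j, |x j| ≤ max 1 c := by
    intro j
    by_cases h1 : |x j| ≤ 1
    · exact h1.trans (le_max_left _ _)
    · push Not at h1
      have h2 : x j ^ D ≤ c :=
        (Finset.single_le_sum (f := fun j => x j ^ D) (fun i _ => hD.pow_nonneg _)
          (Finset.mem_univ j)).trans hx
      have h3 : |x j| ≤ |x j| ^ D := le_self_pow₀ h1.le hD0
      rw [hD.pow_abs] at h3
      exact (h3.trans h2).trans (le_max_right _ _)
  exact ⟨fun j => (abs_le.1 (hj j)).1, fun j => (abs_le.1 (hj j)).2⟩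

open MvPolynomial in
lemma yat_localMin {ι κ : Type*} [Fintype ι] [Fintype κ]
    (f : ι → MvPolynomial κ ℝ) (e : ι → ℝ) (he : ∀ i, 0 < e i) (I : Finset ι) (B : Finset ι)
    (D : ℕ) (hD : Even D) (hD0 : D ≠ 0)
    (hp : ∃ x, (∀ i, 0 < yatSg B i * eval x (f i)) ∧ (∀ i, e i ≤ eval x (f i) ^ 2) ∧
      ∀ i ∈ I, eval x (f i) ^ 2 = e i)
    (hmax : ∀ x, (∀ i, 0 < yatSg B i * eval x (f i)) → (∀ i, e i ≤ eval x (f i) ^ 2) →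
      (∀ i ∈ I, eval x (f i) ^ 2 = e i) → ∀ i ∉ I, eval x (f i) ^ 2 ≠ e i) :
    ∃ η₀ > 0, ∀ η, 0 < η → η < η₀ → ∃ x, (∀ i, 0 < yatSg B i * eval x (f i)) ∧
      IsLocalMin (fun x : κ → ℝ => ∑ i ∈ I, (eval x (f i) ^ 2 - e i) ^ 2 + η * ∑ j, x j ^ D) x := by
  classical
  obtain ⟨p, hp1, hp2, hp3⟩ := hp
  have hsg : ∀ i, yatSg B i ≠ 0 := by
    intro i; unfold yatSg; split_ifs <;> norm_num
  have hcf : ∀ i, Continuous fun x => eval x (f i) := fun i => MvPolynomial.continuous_eval _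
  set Q : (κ → ℝ) → ℝ := fun x => ∑ j, x j ^ D with hQ
  have hQ0 : ∀ x, 0 ≤ Q x := fun x => Finset.sum_nonneg fun j _ => hD.pow_nonneg _
  have hQc : Continuous Q := by fun_prop
  set G : (κ → ℝ) → ℝ := fun x => ∑ i ∈ I, (eval x (f i) ^ 2 - e i) ^ 2 with hG
  have hG0 : ∀ x, 0 ≤ G x := fun x => Finset.sum_nonneg fun j _ => sq_nonneg _
  have hGc : Continuous G := by
    refine continuous_finsetSum _ fun i _ => ?_
    have := hcf i
    fun_prop
  have hGz : ∀ x, G x = 0 → ∀ i ∈ I, eval x (f i) ^ 2 = e i := by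
    intro x hx i hi
    have := (Finset.sum_eq_zero_iff_of_nonneg (fun i _ => sq_nonneg _)).1 hx i hi
    exact sub_eq_zero.1 (pow_eq_zero_iff (two_ne_zero) |>.1 this)
  have hGp : G p = 0 := Finset.sum_eq_zero fun i hi => by rw [hp3 i hi]; simp
  -- the closed region
  let U : Set (κ → ℝ) := {x | (∀ i, 0 ≤ yatSg B i * eval x (f i)) ∧
    ∀ i ∉ I, e i ≤ eval x (f i) ^ 2}
  have hUc : IsClosed U := by
    have h1 : IsClosed {x : κ → ℝ | ∀ i, 0 ≤ yatSg B i * eval x (f i)} := by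
      simp only [Set.ofPred_forall]
      exact isClosed_iInter fun i => isClosed_le continuous_const (continuous_const.mul (hcf i))
    have h2 : IsClosed {x : κ → ℝ | ∀ i ∉ I, e i ≤ eval x (f i) ^ 2} := by
      simp only [Set.ofPred_forall]
      exact isClosed_iInter fun i => isClosed_iInter fun _ =>
        isClosed_le continuous_const ((hcf i).pow 2)
    exact h1.inter h2
  let K : Set (κ → ℝ) := {x | Q x ≤ Q p} ∩ U
  have hK : IsCompact K := (yat_compact D hD hD0 _).inter_right hUc
  have hpK : p ∈ K := ⟨le_refl (Q p), fun i => (hp1 i).le, fun i _ => hp2 i⟩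
  -- the bad set
  let L : Set (κ → ℝ) := K ∩ {x | (∃ i ∈ I, eval x (f i) = 0) ∨
    ∃ i ∈ (Finset.univ \ I), eval x (f i) ^ 2 = e i}
  have hLc : IsCompact L := by
    refine hK.inter_right (IsClosed.union ?_ ?_)
    · have : {x : κ → ℝ | ∃ i ∈ I, eval x (f i) = 0} =
          ⋃ i ∈ I, {x : κ → ℝ | eval x (f i) = 0} := by ext; simp
      change IsClosed {x : κ → ℝ | ∃ i ∈ I, eval x (f i) = 0}
      rw [this]
      exact isClosed_biUnion_finset fun i _ => isClosed_eq (hcf i) continuous_const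
    · have : {x : κ → ℝ | ∃ i ∈ (Finset.univ \ I), eval x (f i) ^ 2 = e i} =
          ⋃ i ∈ (Finset.univ \ I), {x : κ → ℝ | eval x (f i) ^ 2 = e i} := by ext; simp
      change IsClosed {x : κ → ℝ | ∃ i ∈ (Finset.univ \ I), eval x (f i) ^ 2 = e i}
      rw [this]
      exact isClosed_biUnion_finset fun i _ => isClosed_eq ((hcf i).pow 2) continuous_const
  have hLpos : ∀ x ∈ L, 0 < G x := by
    rintro x ⟨⟨_, hx1, hx2⟩, hx3⟩
    refine lt_of_le_of_ne (hG0 x) fun h0 => ?_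
    have hz := hGz x h0.symm
    have hge : ∀ i, e i ≤ eval x (f i) ^ 2 := by
      intro i
      by_cases hi : i ∈ I
      · exact (hz i hi).ge
      · exact hx2 i hi
    have hne : ∀ i, eval x (f i) ≠ 0 := by
      intro i h
      have := hge i
      rw [h] at this
      have := he i
      norm_num at *
      linarith
    rcases hx3 with ⟨i, hi, h⟩ | ⟨i, hi, h⟩
    · exact hne i h
    · refine hmax x (fun i => lt_of_le_of_ne (hx1 i) ?_) hge hz i (by simpa using hi) h
      exact (mul_ne_zero (hsg i) (hne i)).symm
  obtain ⟨c, hc, hcL⟩ : ∃ c > 0, ∀ x ∈ L, c ≤ G x := by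
    rcases L.eq_empty_or_nonempty with h | h
    · exact ⟨1, one_pos, by simp [h]⟩
    · obtain ⟨x, hx, hmin⟩ := hLc.exists_isMinOn h hGc.continuousOn
      exact ⟨G x, hLpos x hx, fun y hy => hmin hy⟩
  refine ⟨c / (Q p + 1), div_pos hc (by linarith [hQ0 p]), fun η hη hηc => ?_⟩
  have hηQ : η * Q p < c := by
    rw [lt_div_iff₀ (by linarith [hQ0 p])] at hηc
    nlinarith
  obtain ⟨x, hx, hmin⟩ := hK.exists_isMinOn ⟨p, hpK⟩
    (f := fun x => G x + η * Q x) (by fun_prop)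
  have hxp : G x + η * Q x ≤ η * Q p := by
    have := hmin hpK
    simp only [Set.mem_ofPred_eq, hGp] at this
    linarith
  have hGx : G x < c := by
    have := mul_nonneg hη.le (hQ0 x)
    linarith
  have hxL : x ∉ L := fun h => absurd (hcL x h) (by linarith)
  have hxL1 : ∀ i ∈ I, eval x (f i) ≠ 0 := fun i hi h => hxL ⟨hx, Or.inl ⟨i, hi, h⟩⟩
  have hxL2 : ∀ i ∉ I, e i < eval x (f i) ^ 2 := fun i hi =>
    lt_of_le_of_ne (hx.2.2 i hi) fun h => hxL ⟨hx, Or.inr ⟨i, by simpa using hi, h.symm⟩⟩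
  have hne : ∀ i, eval x (f i) ≠ 0 := by
    intro i
    by_cases hi : i ∈ I
    · exact hxL1 i hi
    · intro h
      have h1 := hxL2 i hi
      rw [h] at h1
      have := he i
      norm_num at h1
      linarith
  have hpos : ∀ i, 0 < yatSg B i * eval x (f i) := fun i =>
    lt_of_le_of_ne (hx.2.1 i) (mul_ne_zero (hsg i) (hne i)).symm
  refine ⟨x, hpos, ?_⟩
  have hev1 : ∀ᶠ y in nhds x, ∀ i, 0 < yatSg B i * eval y (f i) :=
    Filter.eventually_all.2 fun i =>
      (continuous_const.mul (hcf i)).continuousAt.eventually (lt_mem_nhds (hpos i))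
  have hev2 : ∀ᶠ y in nhds x, ∀ i, i ∉ I → e i < eval y (f i) ^ 2 := by
    refine Filter.eventually_all.2 fun i => ?_
    by_cases hi : i ∈ I
    · simp [hi]
    · have := ((hcf i).pow 2).continuousAt.eventually (lt_mem_nhds (hxL2 i hi))
      filter_upwards [this] with y hy _ using hy
  filter_upwards [hev1, hev2] with y hy1 hy2
  by_cases hyQ : Q y ≤ Q p
  · exact hmin (⟨hyQ, fun i => (hy1 i).le, fun i hi => (hy2 i hi).le⟩ : y ∈ K)
  · push Not at hyQ
    have h1 : η * Q p < η * Q y := mul_lt_mul_of_pos_left hyQ hη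
    have h2 := hG0 y
    change G x + η * Q x ≤ G y + η * Q y
    linarith

open MvPolynomial in
lemma yat_fiber {ι κ : Type*} [Fintype ι] [Fintype κ]
    (f : ι → MvPolynomial κ ℝ) (s : ℕ) (hf : ∀ i, (f i).totalDegree ≤ s)
    (e : ι → ℝ) (he : ∀ i, 0 < e i) (I : Finset ι) (𝓑 : Finset (Finset ι))
    (hp : ∀ B ∈ 𝓑, ∃ x, (∀ i, 0 < yatSg B i * eval x (f i)) ∧ (∀ i, e i ≤ eval x (f i) ^ 2) ∧
      ∀ i ∈ I, eval x (f i) ^ 2 = e i)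
    (hmax : ∀ B ∈ 𝓑, ∀ x, (∀ i, 0 < yatSg B i * eval x (f i)) → (∀ i, e i ≤ eval x (f i) ^ 2) →
      (∀ i ∈ I, eval x (f i) ^ 2 = e i) → ∀ i ∉ I, eval x (f i) ^ 2 ≠ e i) :
    𝓑.card ≤ (4 * s + 1) ^ Fintype.card κ := by
  classical
  have hloc := fun B : 𝓑 => yat_localMin f e he I B (4 * s + 2) ⟨2 * s + 1, by ring⟩ (by omega)
    (hp B B.2) (hmax B B.2)
  choose η₀ hη₀ hloc using hloc
  obtain ⟨η, hη, hηlt⟩ : ∃ η > 0, ∀ B, η < η₀ B := by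
    have h1 : ∀ᶠ η in nhdsWithin (0 : ℝ) (Set.Ioi 0), ∀ B, η < η₀ B :=
      Filter.eventually_all.2 fun B => nhdsWithin_le_nhds (gt_mem_nhds (hη₀ B))
    obtain ⟨η, h1, h2⟩ := (h1.and self_mem_nhdsWithin).exists
    exact ⟨η, h2, h1⟩
  choose x hx hmin using fun B => hloc B η hη (hηlt B)
  have hinj : Function.Injective x := by
    intro B C hBC
    ext i
    have h1 := hx B i
    have h2 := hx C i
    rw [← hBC] at h2
    unfold yatSg at h1 h2
    split_ifs at h1 h2 with h3 h4 h4 <;> simp_all <;> linarith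
  let G : MvPolynomial κ ℝ := ∑ i ∈ I, (f i ^ 2 - C (e i)) ^ 2
  have hGdeg : G.totalDegree ≤ 4 * s := by
    refine totalDegree_finsetSum_le fun i _ => ?_
    refine (totalDegree_pow _ _).trans ?_
    have h1 : (f i ^ 2 - C (e i)).totalDegree ≤ 2 * s := by
      refine (totalDegree_sub _ _).trans (max_le ?_ (by simp))
      exact (totalDegree_pow _ _).trans (Nat.mul_le_mul_left _ (hf i))
    omega
  have hb := yat_bezout (4 * s + 1) (η * (4 * s + 2 : ℕ)) (by positivity) (fun j => pderiv j G)
    (fun j => by have := yat_totalDegree_pderiv G j; omega) (Finset.univ.image x) (by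
      intro y hy j
      obtain ⟨B, _, rfl⟩ := Finset.mem_image.1 hy
      let g : MvPolynomial κ ℝ := G + C η * ∑ j, X j ^ (4 * s + 2)
      have hg : ∀ y, eval y g =
          ∑ i ∈ I, (eval y (f i) ^ 2 - e i) ^ 2 + η * ∑ j, y j ^ (4 * s + 2) := by
        intro y; simp [g, G, map_sum]
      have hm : IsLocalMin (fun y => eval y g) (x B) := by
        simp only [hg]; exact hmin B
      have hd := yat_hasDerivAt g (x B) j
      have hm' : IsLocalMin (fun t : ℝ => eval (x B + t • Pi.single j (1 : ℝ)) g) 0 := by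
        have hcont : ContinuousAt (fun t : ℝ => x B + t • (Pi.single j (1 : ℝ) : κ → ℝ)) 0 := by
          fun_prop
        have hm2 : IsLocalMin (fun y => eval y g)
            ((fun t : ℝ => x B + t • (Pi.single j (1 : ℝ) : κ → ℝ)) 0) := by simpa using hm
        exact hcont.eventually hm2
      have h0 := hm'.hasDerivAt_eq_zero hd
      simp only [g, map_add, pderiv_C_mul, map_sum, map_mul, eval_C] at h0
      rw [Finset.sum_eq_single j] at h0
      · rw [pderiv_pow, pderiv_X_self] at h0
        simp at h0
        push_cast
        linarith
      · intro b _ hbj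
        rw [pderiv_pow, pderiv_X_of_ne hbj]; simp
      · simp)
  rw [Finset.card_image_of_injective _ hinj] at hb
  simpa using hb

open MvPolynomial in
lemma yat_count {ι κ : Type*} [Fintype ι] [Fintype κ]
    (f : ι → MvPolynomial κ ℝ) (s : ℕ) (hf : ∀ i, (f i).totalDegree ≤ s)
    (hsh : ∀ B : Finset ι, ∃ x, ∀ i, 0 < yatSg B i * eval x (f i)) :
    2 ^ Fintype.card ι ≤ (∑ j ∈ Finset.range (Fintype.card κ + 1), (Fintype.card ι).choose j) *
      (4 * s + 1) ^ Fintype.card κ := by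
  classical
  choose p hp using hsh
  obtain ⟨b, hb, hbp⟩ : ∃ b > 0, ∀ B i, b < eval (p B) (f i) ^ 2 := by
    have h1 : ∀ᶠ b in nhdsWithin (0 : ℝ) (Set.Ioi 0), ∀ B i, b < eval (p B) (f i) ^ 2 := by
      refine Filter.eventually_all.2 fun B => Filter.eventually_all.2 fun i =>
        nhdsWithin_le_nhds (gt_mem_nhds ?_)
      have := right_ne_zero_of_mul (hp B i).ne'
      positivity
    obtain ⟨b, h1, h2⟩ := (h1.and self_mem_nhdsWithin).exists
    exact ⟨b, h2, h1⟩
  obtain ⟨e, he, hgen⟩ := yat_genpos (fun i => f i ^ 2) b hb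
  have hI : ∀ B : Finset ι, ∃ I : Finset ι,
      (∃ x, (∀ i, 0 < yatSg B i * eval x (f i)) ∧ (∀ i, e i ≤ eval x (f i) ^ 2) ∧
      ∀ i ∈ I, eval x (f i) ^ 2 = e i) ∧
      (∀ x, (∀ i, 0 < yatSg B i * eval x (f i)) → (∀ i, e i ≤ eval x (f i) ^ 2) →
      (∀ i ∈ I, eval x (f i) ^ 2 = e i) → ∀ i ∉ I, eval x (f i) ^ 2 ≠ e i) := by
    intro B
    let 𝓘 : Finset (Finset ι) := Finset.univ.filter fun I =>
      (∃ x, (∀ i, 0 < yatSg B i * eval x (f i)) ∧ (∀ i, e i ≤ eval x (f i) ^ 2) ∧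
      ∀ i ∈ I, eval x (f i) ^ 2 = e i)
    have hne : 𝓘.Nonempty := ⟨∅, by
      simp only [𝓘, Finset.mem_filter, Finset.mem_univ, true_and]
      exact ⟨p B, hp B, fun i => ((he i).2.trans (hbp B i)).le, by simp⟩⟩
    obtain ⟨I, hI, hmax⟩ := 𝓘.exists_max_image Finset.card hne
    refine ⟨I, (Finset.mem_filter.1 hI).2, fun x h1 h2 h3 i hi h4 => ?_⟩
    have hmem : insert i I ∈ 𝓘 := by
      simp only [𝓘, Finset.mem_filter, Finset.mem_univ, true_and]
      refine ⟨x, h1, h2, fun l hl => ?_⟩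
      rcases Finset.mem_insert.1 hl with rfl | hl
      · exact h4
      · exact h3 l hl
    have := hmax _ hmem
    rw [Finset.card_insert_of_notMem hi] at this
    omega
  choose I hI1 hI2 using hI
  let T : Finset (Finset ι) := (Finset.range (Fintype.card κ + 1)).biUnion
    fun j => Finset.powersetCard j Finset.univ
  have hT : T.card ≤ ∑ j ∈ Finset.range (Fintype.card κ + 1), (Fintype.card ι).choose j := by
    refine Finset.card_biUnion_le.trans (Finset.sum_le_sum fun j _ => ?_)
    rw [Finset.card_powersetCard, Finset.card_univ]
  have hmaps : ∀ B ∈ (Finset.univ : Finset (Finset ι)), I B ∈ T := by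
    intro B _
    have : (I B).card ≤ Fintype.card κ := by
      by_contra hcon
      push Not at hcon
      obtain ⟨x, _, _, hx⟩ := hI1 B
      exact hgen (I B) hcon ⟨x, fun i hi => by rw [map_pow]; exact hx i hi⟩
    simp only [T, Finset.mem_biUnion, Finset.mem_range, Finset.mem_powersetCard]
    exact ⟨_, Nat.lt_succ_of_le this, Finset.subset_univ _, rfl⟩
  have hcard := Finset.card_le_mul_card_image_of_maps_to hmaps ((4 * s + 1) ^ Fintype.card κ) (by
    intro J _
    apply yat_fiber f s hf e (fun i => (he i).1) J
    · intro B hB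
      rw [← (Finset.mem_filter.1 hB).2]
      exact hI1 B
    · intro B hB
      rw [← (Finset.mem_filter.1 hB).2]
      exact hI2 B)
  rw [Finset.card_univ, Fintype.card_finset] at hcard
  calc _ ≤ _ := hcard
    _ ≤ _ := by rw [mul_comm]; exact Nat.mul_le_mul_right _ hT

lemma yat_sum_choose (m k : ℕ) (hk : 0 < k) (hkm : k ≤ m) :
    (∑ j ∈ Finset.range (k + 1), (m.choose j : ℝ)) ≤ (Real.exp 1 * (m / k)) ^ k := by
  have hk' : (0 : ℝ) < k := by exact_mod_cast hk
  have hm' : (0 : ℝ) < m := by exact_mod_cast hk.trans_le hkm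
  have hkm' : (k : ℝ) ≤ m := by exact_mod_cast hkm
  set u : ℝ := k / m with hu
  have hu0 : 0 < u := by positivity
  have hu1 : u ≤ 1 := by rw [hu, div_le_one hm']; exact hkm'
  have h1 : (∑ j ∈ Finset.range (k + 1), (m.choose j : ℝ)) * u ^ k ≤ (u + 1) ^ m := by
    rw [add_pow, Finset.sum_mul]
    calc ∑ j ∈ Finset.range (k + 1), (m.choose j : ℝ) * u ^ k
        ≤ ∑ j ∈ Finset.range (k + 1), u ^ j * 1 ^ (m - j) * (m.choose j : ℝ) := by
          refine Finset.sum_le_sum fun j hj => ?_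
          have : u ^ k ≤ u ^ j :=
            pow_le_pow_of_le_one hu0.le hu1 (Nat.lt_succ_iff.1 (Finset.mem_range.1 hj))
          rw [one_pow, mul_one, mul_comm]
          gcongr
      _ ≤ _ := by
          refine Finset.sum_le_sum_of_subset_of_nonneg ?_ fun j _ _ => by positivity
          intro j hj
          simp only [Finset.mem_range] at *
          omega
  have h2 : (u + 1) ^ m ≤ Real.exp 1 ^ k := by
    calc (u + 1) ^ m ≤ Real.exp u ^ m := by
          gcongr
          exact Real.add_one_le_exp u
      _ = Real.exp 1 ^ k := by
          rw [← Real.exp_nat_mul, ← Real.exp_nat_mul]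
          congr 1
          rw [hu]; field_simp
  have h3 : (m / k : ℝ) = u⁻¹ := by rw [hu, inv_div]
  rw [h3, mul_pow, inv_pow, ← div_eq_mul_inv, le_div_iff₀ (by positivity)]
  exact h1.trans h2

lemma yat_final (m N s : ℕ) (hN : 1 ≤ N) (hs : 1 ≤ s)
    (h : 2 ^ m ≤ (∑ j ∈ Finset.range (2 * N + 1), m.choose j) * (4 * s + 1) ^ (2 * N)) :
    (m : ℝ) ≤ 4 * N * Real.logb 2 (4 * Real.exp 1 * s) := by
  have hs' : (1 : ℝ) ≤ s := by exact_mod_cast hs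
  have hN' : (1 : ℝ) ≤ N := by exact_mod_cast hN
  have hl2 := Real.log_two_gt_d9
  have hl2' := Real.log_two_lt_d9
  have hls : 0 ≤ Real.log s := Real.log_nonneg hs'
  have hlog : Real.logb 2 (4 * Real.exp 1 * s) = (2 * Real.log 2 + 1 + Real.log s) / Real.log 2 := by
    rw [Real.logb, Real.log_mul (by positivity) (by positivity),
      Real.log_mul (by positivity) (by positivity), Real.log_exp,
      show (4 : ℝ) = 2 ^ 2 by norm_num, Real.log_pow]
    norm_num
  rw [hlog]
  by_cases hm : m ≤ 2 * N
  · have hm' : (m : ℝ) ≤ 2 * N := by exact_mod_cast hm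
    have : 1 ≤ (2 * Real.log 2 + 1 + Real.log s) / Real.log 2 := by
      rw [le_div_iff₀ (by linarith)]; linarith
    nlinarith
  · push Not at hm
    set k := 2 * N with hk
    have hk0 : 0 < k := by omega
    have hkR : (0 : ℝ) < k := by exact_mod_cast hk0
    have hmR : (0 : ℝ) < m := by exact_mod_cast hk0.trans hm
    set t : ℝ := m / k with ht
    have ht0 : 0 < t := by positivity
    have hmt : (m : ℝ) = t * k := by rw [ht]; field_simp
    have h1 : (2 : ℝ) ^ m ≤ (Real.exp 1 * t * (4 * s + 1)) ^ k := by
      have : (2 : ℝ) ^ m ≤ (∑ j ∈ Finset.range (k + 1), (m.choose j : ℝ)) * (4 * s + 1) ^ k := by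
        exact_mod_cast h
      refine this.trans ?_
      rw [mul_pow]
      gcongr
      exact yat_sum_choose m k hk0 hm.le
    have h2 : (2 : ℝ) ^ m ≤ (Real.exp 1 * t * (5 * s)) ^ k := by
      refine h1.trans ?_
      gcongr
      linarith
    have h3 := Real.log_le_log (by positivity) h2
    rw [Real.log_pow, Real.log_pow, Real.log_mul (by positivity) (by positivity),
      Real.log_mul (by positivity) (by positivity), Real.log_exp,
      Real.log_mul (by positivity) (by positivity), hmt] at h3
    have h4 : t * Real.log 2 ≤ 1 + Real.log t + (Real.log 5 + Real.log s) := by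
      have : k * (t * Real.log 2) ≤ k * (1 + Real.log t + (Real.log 5 + Real.log s)) := by
        linarith
      exact le_of_mul_le_mul_left this hkR
    have h5 : Real.log t ≤ t / 8 - 1 + 3 * Real.log 2 := by
      have := Real.log_le_sub_one_of_pos (show 0 < t / 8 by positivity)
      rw [Real.log_div ht0.ne' (by norm_num), show (8 : ℝ) = 2 ^ 3 by norm_num, Real.log_pow] at this
      norm_num at this ⊢
      linarith
    have h6 : 3 * Real.log 5 ≤ 7 * Real.log 2 := by
      have := Real.log_le_log (by norm_num) (show (5 : ℝ) ^ 3 ≤ 2 ^ 7 by norm_num)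
      rw [Real.log_pow, Real.log_pow] at this
      exact_mod_cast this
    have h7 : t ≤ 2 * ((2 * Real.log 2 + 1 + Real.log s) / Real.log 2) := by
      have h8 : t * 0.568 ≤ 3.69685 + Real.log s := by nlinarith
      rw [← mul_div_assoc, le_div_iff₀ (by linarith)]
      nlinarith
    rw [hmt, hk]
    push_cast
    nlinarith

theorem stmt_9 {Z : Type*} (N s : ℕ) (hN : 1 ≤ N) (hs : 1 ≤ s)
    (Λ : Set (Fin N → ℝ)) (p : (Fin N → ℝ) → Z → ℝ)
    (hpoly : ∀ z : Z, ∃ q : MvPolynomial (Fin N) ℝ,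
      q.totalDegree ≤ s ∧ ∀ θ ∈ Λ, p θ z = MvPolynomial.eval θ q)
    (𝒜 : Set (Set Z))
    (h𝒜 : 𝒜 = {A | ∃ θ ∈ Λ, ∃ θ' ∈ Λ, θ ≠ θ' ∧ A = {z | p θ' z < p θ z}}) :
    ∀ S : Finset Z, Shatters 𝒜 S →
      (S.card : ℝ) ≤ 4 * N * Real.logb 2 (4 * Real.exp 1 * s) := by
  classical
  intro S hS
  choose q hq hqp using hpoly
  have hB : ∀ B : Finset S, ∃ θ ∈ Λ, ∃ θ' ∈ Λ, ∀ z : S, p θ' z < p θ z ↔ z ∈ B := by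
    intro B
    obtain ⟨A, hA, hAB⟩ := hS (B.map (Function.Embedding.subtype _)) (by
      intro z hz
      obtain ⟨w, _, rfl⟩ := Finset.mem_map.1 hz
      exact w.2)
    rw [h𝒜] at hA
    obtain ⟨θ, hθ, θ', hθ', _, rfl⟩ := hA
    refine ⟨θ, hθ, θ', hθ', fun z => ?_⟩
    have := hAB z z.2
    simpa using this
  choose θ hθ θ' hθ' hiff using hB
  obtain ⟨η, hη, hηlt⟩ : ∃ η > 0, ∀ (B : Finset S) (z : S), z ∈ B →
      η < p (θ B) z - p (θ' B) z := by
    have h1 : ∀ᶠ b in nhdsWithin (0 : ℝ) (Set.Ioi 0), ∀ (B : Finset S) (z : S), z ∈ B →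
        b < p (θ B) z - p (θ' B) z := by
      refine Filter.eventually_all.2 fun B => Filter.eventually_all.2 fun z => ?_
      by_cases hz : z ∈ B
      · have := (hiff B z).2 hz
        filter_upwards [nhdsWithin_le_nhds (gt_mem_nhds (sub_pos.2 this))] with b hb _ using hb
      · simp [hz]
    obtain ⟨b, h1, h2⟩ := (h1.and self_mem_nhdsWithin).exists
    exact ⟨b, h2, h1⟩
  let f : S → MvPolynomial (Fin N ⊕ Fin N) ℝ := fun z =>
    MvPolynomial.rename Sum.inl (q z) - MvPolynomial.rename Sum.inr (q z) - MvPolynomial.C η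
  have hf : ∀ z, (f z).totalDegree ≤ s := by
    intro z
    refine (MvPolynomial.totalDegree_sub _ _).trans (max_le ?_ (by simp))
    exact (MvPolynomial.totalDegree_sub _ _).trans (max_le
      ((MvPolynomial.totalDegree_rename_le _ _).trans (hq z))
      ((MvPolynomial.totalDegree_rename_le _ _).trans (hq z)))
  have hc := yat_count f s hf (by
    intro B
    refine ⟨Sum.elim (θ B) (θ' B), fun z => ?_⟩
    have hev : MvPolynomial.eval (Sum.elim (θ B) (θ' B)) (f z) =
        p (θ B) z - p (θ' B) z - η := by
      simp only [f, map_sub, MvPolynomial.eval_rename, MvPolynomial.eval_C, Sum.elim_comp_inl,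
        Sum.elim_comp_inr]
      rw [hqp z _ (hθ B), hqp z _ (hθ' B)]
    rw [hev]
    unfold yatSg
    split_ifs with hz
    · have := hηlt B z hz
      linarith
    · have := mt (hiff B z).1 hz
      linarith)
  apply yat_final S.card N s hN hs
  simpa [two_mul] using hc
end

section
/- Let n ≥ 1, p ≥ 1, Λ ⊆ ℝ^p, and for each θ ∈ Λ let Σ(θ) be a positive-definite n × n real matrix such that every entry of the inverse matrix Σ(θ)^{−1} is the restriction to Λ of a polynomial of degree at most 2 in θ. Let p_θ(xⁿ) = (2π)^{−n/2} (det Σ(θ))^{−1/2} exp(−(1/2) (xⁿ)ᵀ Σ(θ)^{−1} xⁿ) be the centered Gaussian density on ℝⁿ with covariance Σ(θ). Then the Yatracos class 𝒜_n = { { xⁿ ∈ ℝⁿ : p_θ(xⁿ) > p_{θ'}(xⁿ) } : θ, θ' ∈ Λ, θ ≠ θ' } is a VC class with VC dimension at most (4p + 4) log₂(8 e). -/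
open scoped Real Matrix

section Helpers

open MvPolynomial

theorem mvp_hasFDerivAt {ι : Type*} [Fintype ι] [DecidableEq ι] (f : MvPolynomial ι ℝ) (x : ι → ℝ) :
    HasFDerivAt (fun y : ι → ℝ => eval y f)
      (∑ j, (eval x (pderiv j f)) • (ContinuousLinearMap.proj j : (ι → ℝ) →L[ℝ] ℝ)) x := by
  induction f using MvPolynomial.induction_on with
  | C a => simpa using hasFDerivAt_const a x
  | add p q hp hq =>
    have := hp.add hq
    simp only [map_add, add_smul, Finset.sum_add_distrib]
    exact this
  | mul_X p k hp =>
    have h1 : HasFDerivAt (fun y : ι → ℝ => y k) (ContinuousLinearMap.proj k : (ι → ℝ) →L[ℝ] ℝ) x :=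
      (ContinuousLinearMap.proj k : (ι → ℝ) →L[ℝ] ℝ).hasFDerivAt
    have := hp.mul h1
    simp only [map_mul, eval_X]
    refine this.congr_fderiv ?_
    ext v
    simp [pderiv_mul, pderiv_X, Pi.single_apply, add_mul, Finset.sum_add_distrib, Finset.mul_sum,
      apply_ite, mul_ite, ite_mul]
    exact Finset.sum_congr rfl fun i _ => by ring

theorem mvp_contDiff {ι : Type*} [Fintype ι] (f : MvPolynomial ι ℝ) :
    ContDiff ℝ 1 (fun y : ι → ℝ => eval y f) := by
  induction f using MvPolynomial.induction_on with
  | C a => simpa using contDiff_const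
  | add p q hp hq => simpa using hp.add hq
  | mul_X p k hp => simpa using hp.mul (contDiff_apply ℝ ℝ k)

/-- First order Taylor expansion with polynomial coefficients of smaller degree. -/
theorem mvp_taylor_mon {ι : Type*} [Fintype ι] [DecidableEq ι] (z : ι → ℝ) (N : ℕ) :
    ∀ s : ι →₀ ℕ, s.degree ≤ N + 1 → ∃ q : ι → MvPolynomial ι ℝ, (∀ j, (q j).totalDegree ≤ N) ∧
      monomial s (1:ℝ) = C (eval z (monomial s (1:ℝ))) + ∑ j, q j * (X j - C (z j)) := by
  induction N with
  | zero =>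
    intro s hs
    by_cases h0 : s = 0
    · subst h0
      exact ⟨0, by simp, by simp⟩
    · obtain ⟨k, hk⟩ : ∃ k, s k ≠ 0 := by
        by_contra h; push Not at h; exact h0 (Finsupp.ext h)
      have h1 : s = Finsupp.single k 1 := by
        obtain ⟨t, rfl⟩ : ∃ t, s = Finsupp.single k 1 + t :=
          exists_add_of_le (by simpa [Finsupp.single_le_iff] using Nat.one_le_iff_ne_zero.2 hk)
        have : t.degree = 0 := by simp [Finsupp.degree_single] at hs; simp [hs]
        rw [Finsupp.degree_eq_zero_iff] at this
        simp [this]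
      subst h1
      refine ⟨Pi.single k 1, fun j => ?_, ?_⟩
      · by_cases h : j = k
        · subst h; simp
        · simp [h]
      · simp [Pi.single_apply, eval_monomial]
        rfl
  | succ N ih =>
    intro s hs
    by_cases h0 : s = 0
    · subst h0
      exact ⟨0, by simp, by simp⟩
    · obtain ⟨k, hk⟩ : ∃ k, s k ≠ 0 := by
        by_contra h; push Not at h; exact h0 (Finsupp.ext h)
      obtain ⟨t, rfl⟩ : ∃ t, s = Finsupp.single k 1 + t :=
          exists_add_of_le (by simpa [Finsupp.single_le_iff] using Nat.one_le_iff_ne_zero.2 hk)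
      have ht : t.degree ≤ N + 1 := by simp [Finsupp.degree_single] at hs; omega
      obtain ⟨q, hq, hq'⟩ := ih t ht
      have hm : monomial (Finsupp.single k 1 + t) (1:ℝ) = X k * monomial t 1 := by
        simp [X, monomial_mul]
      refine ⟨fun j => C (z k) * q j + Pi.single (M := fun _ => MvPolynomial ι ℝ) k (monomial t 1) j, fun j => ?_, ?_⟩
      · refine (totalDegree_add _ _).trans (max_le ?_ ?_)
        · refine (totalDegree_mul _ _).trans ?_
          have := hq j
          simp; omega
        · by_cases h : j = k
          · subst h
            simp only [Pi.single_eq_same]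
            refine (totalDegree_monomial_le _ _).trans ?_
            exact ht
          · simp [h]
      · rw [hm]
        simp only [add_mul, Finset.sum_add_distrib, Pi.single_apply, ite_mul, zero_mul,
          Finset.sum_ite_eq', Finset.mem_univ, if_true, mul_assoc, ← Finset.mul_sum, map_mul, eval_X]
        have : ∑ j, q j * (X j - C (z j)) = monomial t 1 - C (eval z (monomial t (1:ℝ))) := by
          rw [eq_sub_iff_add_eq, add_comm]; exact hq'.symm
        rw [this]; ring

theorem mvp_taylor {ι : Type*} [Fintype ι] [DecidableEq ι] (z : ι → ℝ) (N : ℕ)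
    (f : MvPolynomial ι ℝ) (hf : f.totalDegree ≤ N + 1) :
    ∃ q : ι → MvPolynomial ι ℝ, (∀ j, (q j).totalDegree ≤ N) ∧
      f = C (eval z f) + ∑ j, q j * (X j - C (z j)) := by
  have H : ∀ s : ι →₀ ℕ, ∃ q : ι → MvPolynomial ι ℝ, s ∈ f.support → (∀ j, (q j).totalDegree ≤ N) ∧
      monomial s (1:ℝ) = C (eval z (monomial s (1:ℝ))) + ∑ j, q j * (X j - C (z j)) := by
    intro s
    by_cases hs : s ∈ f.support
    · obtain ⟨q, hq⟩ := mvp_taylor_mon z N s ((le_totalDegree hs).trans hf)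
      exact ⟨q, fun _ => hq⟩
    · exact ⟨0, fun h => absurd h hs⟩
  choose q hq using H
  refine ⟨fun j => ∑ s ∈ f.support, C (coeff s f) * q s j, fun j => ?_, ?_⟩
  · refine totalDegree_finsetSum_le fun s hs => (totalDegree_mul _ _).trans ?_
    have := (hq s hs).1 j
    simpa using this
  · have e : f = ∑ s ∈ f.support, C (coeff s f) * monomial s (1:ℝ) := by
      conv_lhs => rw [f.as_sum]
      exact Finset.sum_congr rfl fun s _ => by rw [C_mul_monomial, mul_one]
    have e2 : C (eval z f) = ∑ s ∈ f.support, C (coeff s f) * C (σ := ι) (eval z (monomial s (1:ℝ))) := by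
      conv_lhs => rw [e]
      simp only [map_sum, map_mul, eval_C]
    rw [e2]
    conv_lhs => rw [e]
    simp only [Finset.sum_mul]
    rw [Finset.sum_comm, ← Finset.sum_add_distrib]
    refine Finset.sum_congr rfl fun s hs => ?_
    conv_lhs => rw [(hq s hs).2]
    rw [mul_add, Finset.mul_sum]
    congr 1
    exact Finset.sum_congr rfl fun j _ => by ring

theorem mvp_taylor_deriv {ι : Type*} [Fintype ι] [DecidableEq ι] (z : ι → ℝ)
    (f : MvPolynomial ι ℝ) (q : ι → MvPolynomial ι ℝ)
    (h : f = C (eval z f) + ∑ j, q j * (X j - C (z j))) (k : ι) :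
    eval z (q k) = eval z (pderiv k f) := by
  conv_rhs => rw [h]
  simp [pderiv_mul, pderiv_X, Pi.single_apply, apply_ite]

/-- Number of monomials of degree at most `2D` in `D` variables. -/
theorem monomial_count {ι : Type*} [Fintype ι] [DecidableEq ι] :
    ((Nat.card {s : ι →₀ ℕ | s.degree ≤ 2 * Fintype.card ι} : ℕ) : ℝ) ≤ (27 / 4 : ℝ) ^ Fintype.card ι := by
  set D := Fintype.card ι with hD
  let M : Finset (ι → ℕ) := (Fintype.piFinset fun _ : ι => Finset.range (2 * D + 1)).filter
    (fun s => ∑ i, s i ≤ 2 * D)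
  have h1 : Nat.card {s : ι →₀ ℕ | s.degree ≤ 2 * D} ≤ M.card := by
    have e : ∀ s : ι →₀ ℕ, s.degree = ∑ i, s i := fun s => Finsupp.degree_eq_sum s
    have : M.card = Nat.card M := by simp
    rw [this]
    refine Nat.card_le_card_of_injective (fun s => ⟨fun i => s.1 i, ?_⟩) ?_
    · have hs : s.1.degree ≤ 2 * D := s.2
      rw [e] at hs
      refine Finset.mem_filter.2 ⟨Fintype.mem_piFinset.2 fun i => Finset.mem_range.2 ?_, hs⟩
      have := Finset.single_le_sum (f := fun i => s.1 i) (fun _ _ => Nat.zero_le _) (Finset.mem_univ i)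
      omega
    · intro s t hst
      exact Subtype.ext (DFunLike.coe_injective (Subtype.ext_iff.1 hst))
  have h2 : (M.card : ℝ) * (2 / 3 : ℝ) ^ (2 * D) ≤ 3 ^ D := by
    calc (M.card : ℝ) * (2 / 3 : ℝ) ^ (2 * D) = ∑ s ∈ M, (2 / 3 : ℝ) ^ (2 * D) := by simp
      _ ≤ ∑ s ∈ M, (2 / 3 : ℝ) ^ (∑ i, s i) := by
        refine Finset.sum_le_sum fun s hs => ?_
        exact pow_le_pow_of_le_one (by norm_num) (by norm_num) (Finset.mem_filter.1 hs).2
      _ ≤ ∑ s ∈ (Fintype.piFinset fun _ : ι => Finset.range (2 * D + 1)), ∏ i, (2 / 3 : ℝ) ^ (s i) := by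
        simp only [← Finset.prod_pow_eq_pow_sum]
        exact Finset.sum_le_sum_of_subset_of_nonneg (Finset.filter_subset _ _) fun _ _ _ => by positivity
      _ = (∑ k ∈ Finset.range (2 * D + 1), (2 / 3 : ℝ) ^ k) ^ D := by
        rw [← Finset.prod_univ_sum]; simp [hD]
      _ ≤ 3 ^ D := by
        refine pow_le_pow_left₀ (Finset.sum_nonneg fun _ _ => by positivity) ?_ _
        rw [geom_sum_eq (by norm_num)]
        have : (0:ℝ) ≤ (2/3) ^ (2 * D + 1) := by positivity
        rw [div_le_iff_of_neg (by norm_num)]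
        linarith
  have h3 : (27 / 4 : ℝ) ^ D * (2 / 3 : ℝ) ^ (2 * D) = 3 ^ D := by
    rw [pow_mul, ← mul_pow]; norm_num
  have h4 : (0:ℝ) < (2 / 3 : ℝ) ^ (2 * D) := by positivity
  have h5 : (M.card : ℝ) ≤ (27 / 4 : ℝ) ^ D := by
    rw [← h3] at h2
    exact le_of_mul_le_mul_right h2 h4
  exact le_trans (by exact_mod_cast h1) h5

theorem bezout_bound {ι : Type*} [Fintype ι] [DecidableEq ι] (G : ι → MvPolynomial ι ℝ)
    (hG : ∀ i, (G i).totalDegree ≤ 3) (Z : Finset (ι → ℝ))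
    (hZ : ∀ z ∈ Z, ∀ i, eval z (G i) = 0)
    (hJ : ∀ z ∈ Z, (Matrix.of fun i j => eval z (pderiv j (G i))).det ≠ 0) :
    (Z.card : ℝ) ≤ (27 / 4 : ℝ) ^ Fintype.card ι := by
  choose q hq hq' using fun (z : ι → ℝ) (i : ι) => mvp_taylor z 2 (G i) (hG i)
  let B : (ι → ℝ) → MvPolynomial ι ℝ := fun z => (Matrix.of fun i j => q z i j).det
  have hev : ∀ z w, eval w (B z) = (Matrix.of fun i j => eval w (q z i j)).det := by
    intro z w
    simp only [B]
    rw [RingHom.map_det]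
    rfl
  have hdeg : ∀ z, (B z).totalDegree ≤ 2 * Fintype.card ι := by
    intro z
    simp only [B, Matrix.det_apply]
    refine totalDegree_finsetSum_le fun σ _ => ?_
    have h1 : (∏ i, (Matrix.of fun i j => q z i j) (σ i) i).totalDegree ≤ 2 * Fintype.card ι := by
      refine (totalDegree_finsetProd _ _).trans ?_
      refine (Finset.sum_le_sum (fun i _ => hq z (σ i) i)).trans ?_
      simp [mul_comm]
    rcases Int.units_eq_one_or (Equiv.Perm.sign σ) with h | h
    · rw [h, one_smul]; exact h1
    · rw [h, Units.neg_smul, one_smul, totalDegree_neg]; exact h1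
  have hdiag : ∀ z ∈ Z, eval z (B z) ≠ 0 := by
    intro z hz
    rw [hev]
    convert hJ z hz using 5 with i j
    exact mvp_taylor_deriv z (G i) (q z i) (hq' z i) j
  have hoff : ∀ z ∈ Z, ∀ w ∈ Z, w ≠ z → eval w (B z) = 0 := by
    intro z hz w hw hne
    rw [hev]
    refine Matrix.exists_mulVec_eq_zero_iff.1 ⟨w - z, sub_ne_zero.2 hne, ?_⟩
    ext i
    have := congrArg (eval w) (hq' z i)
    simp only [map_add, map_sum, map_mul, map_sub, eval_X, eval_C, hZ z hz i, hZ w hw i] at this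
    simp only [Matrix.mulVec, dotProduct, Matrix.of_apply, Pi.sub_apply, Pi.zero_apply]
    linarith
  let V := restrictTotalDegree ι ℝ (2 * Fintype.card ι)
  let b : Z → V := fun z => ⟨B z, (mem_restrictTotalDegree _ _ _).2 (hdeg z)⟩
  have hli : LinearIndependent ℝ b := by
    rw [Fintype.linearIndependent_iff]
    intro g hg w
    have h1 := congrArg (fun v : V => eval w.1 v.1) hg
    simp only [b, Submodule.coe_sum, Submodule.coe_smul, map_sum, smul_eval, Submodule.coe_zero,
      map_zero] at h1
    rw [Finset.sum_eq_single w] at h1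
    · exact (mul_eq_zero.1 h1).resolve_right (hdiag w w.2)
    · intro z _ hzw
      rw [hoff z z.2 w w.2 (fun h => hzw (Subtype.ext h.symm)), mul_zero]
    · simp
  have hc := hli.fintype_card_le_finrank
  have hfr : Module.finrank ℝ V = Nat.card {s : ι →₀ ℕ | s.degree ≤ 2 * Fintype.card ι} :=
    Module.finrank_eq_nat_card_basis (basisRestrictSupport ℝ _)
  rw [hfr, Fintype.card_coe] at hc
  exact le_trans (by exact_mod_cast hc) monomial_count

theorem mvp_totalDegree_pderiv {ι : Type*} [DecidableEq ι] (f : MvPolynomial ι ℝ) (N : ℕ) (hf : f.totalDegree ≤ N + 1)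
    (j : ι) : (pderiv j f).totalDegree ≤ N := by
  rw [totalDegree, Finset.sup_le_iff]
  intro s hs
  rw [mem_support_iff, coeff_pderiv] at hs
  have h1 : coeff (s + Finsupp.single j 1) f ≠ 0 := fun h => hs (by simp [h])
  have h2 : (s + Finsupp.single j 1).degree ≤ N + 1 := (le_totalDegree (mem_support_iff.2 h1)).trans hf
  rw [map_add, Finsupp.degree_single] at h2
  have h3 : s.degree ≤ N := by omega
  exact h3

theorem generic_levels {ι κ : Type*} [Fintype ι] [DecidableEq ι] [Fintype κ] [DecidableEq κ]
    (f : κ → MvPolynomial ι ℝ) (R : ℝ) (U : Set (κ → ℝ)) (hU : IsOpen U) (hne : U.Nonempty) :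
    ∃ c ∈ U, ∀ I : Finset κ, Fintype.card ι < I.card → ∀ θ ∈ Metric.closedBall (0 : ι → ℝ) R,
      ∃ i ∈ I, eval θ (f i) ≠ c i := by
  let F : ∀ I : Finset κ, (ι → ℝ) → (I → ℝ) := fun I θ i => eval θ (f i)
  have hF : ∀ I, ContDiff ℝ 1 (F I) := fun I => contDiff_pi.2 fun i => mvp_contDiff (f i)
  let r : ∀ I : Finset κ, (κ → ℝ) →L[ℝ] (I → ℝ) := fun I =>
    (LinearMap.funLeft ℝ ℝ (Subtype.val : I → κ)).toContinuousLinearMap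
  have hr : ∀ I, Function.Surjective (r I) := fun I =>
    LinearMap.funLeft_surjective_of_injective ℝ ℝ _ Subtype.val_injective
  let O : {I : Finset κ // Fintype.card ι < I.card} → Set (κ → ℝ) := fun I =>
    (r I) ⁻¹' (F I '' Metric.closedBall 0 R)ᶜ
  have hO : ∀ I, IsOpen (O I) := fun I =>
    (((isCompact_closedBall _ _).image (hF I).continuous).isClosed.isOpen_compl).preimage (r I).continuous
  have hd : ∀ I, Dense (O I) := by
    intro I
    refine Dense.preimage ?_ ((r I).isOpenMap (hr I))
    refine Dense.mono ?_ ((hF I).dense_compl_range_of_finrank_lt_finrank ?_)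
    · exact Set.compl_subset_compl.2 (Set.image_subset_range _ _)
    · simpa using I.2
  have hD := dense_iInter_of_isOpen hO hd
  obtain ⟨c, hcU, hc⟩ := hD.inter_open_nonempty U hU hne
  refine ⟨c, hcU, fun I hI θ hθ => ?_⟩
  have h1 := Set.mem_iInter.1 hc ⟨I, hI⟩
  by_contra hcon
  push Not at hcon
  refine h1 ⟨θ, hθ, ?_⟩
  ext i
  exact hcon i i.2

theorem generic_gap {ι κ : Type*} [Fintype ι] [Fintype κ] [DecidableEq κ]
    (f : κ → MvPolynomial ι ℝ) (R : ℝ) (c : κ → ℝ) (d : ℕ) (η₀ : ℝ) (h0 : 0 < η₀)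
    (hc : ∀ I : Finset κ, d < I.card → ∀ θ ∈ Metric.closedBall (0 : ι → ℝ) R,
      ∃ i ∈ I, eval θ (f i) ≠ c i) :
    ∃ η, 0 < η ∧ η ≤ η₀ ∧ ∀ I : Finset κ, d < I.card → ∀ θ ∈ Metric.closedBall (0 : ι → ℝ) R,
      ∃ i ∈ I, η ≤ |eval θ (f i) - c i| := by
  have key : ∀ I : Finset κ, ∀ᶠ η in nhdsWithin (0:ℝ) (Set.Ioi 0), d < I.card →
      ∀ θ ∈ Metric.closedBall (0 : ι → ℝ) R, ∃ i ∈ I, η ≤ |eval θ (f i) - c i| := by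
    intro I
    by_cases hI : d < I.card
    swap
    · exact Filter.Eventually.of_forall fun _ h => absurd h hI
    have hIne : I.Nonempty := Finset.card_pos.1 (by omega)
    have hcont : Continuous fun θ : ι → ℝ => I.sup' hIne (fun i => |eval θ (f i) - c i|) :=
      Continuous.finset_sup'_apply hIne fun i _ => (((mvp_contDiff (f i)).continuous).sub continuous_const).abs
    rcases (Metric.closedBall (0 : ι → ℝ) R).eq_empty_or_nonempty with he | hne
    · exact Filter.Eventually.of_forall fun _ _ θ h => by rw [he] at h; exact absurd h (Set.notMem_empty _)
    obtain ⟨θ₀, h₀, hmin⟩ := (isCompact_closedBall (0 : ι → ℝ) R).exists_isMinOn hne hcont.continuousOn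
    have hpos : 0 < I.sup' hIne (fun i => |eval θ₀ (f i) - c i|) := by
      obtain ⟨i, hi, hne⟩ := hc I hI θ₀ h₀
      exact (Finset.lt_sup'_iff _).2 ⟨i, hi, abs_pos.2 (sub_ne_zero.2 hne)⟩
    filter_upwards [Ioo_mem_nhdsGT hpos] with η hη _ θ hθ
    have := hη.2.le.trans (hmin hθ)
    obtain ⟨i, hi, h⟩ := (Finset.le_sup'_iff _).1 this
    exact ⟨i, hi, h⟩
  have := ((Filter.eventually_all.2 key).and (Ioo_mem_nhdsGT h0)).exists
  obtain ⟨η, h1, h2⟩ := this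
  exact ⟨η, h2.1, h2.2.le, h1⟩

theorem sard_family {ι τ : Type*} [Fintype ι] [DecidableEq ι] [Fintype τ]
    (G : τ → ι → MvPolynomial ι ℝ) :
    ∃ a : ι → ℝ, (∀ j, |a j| ≤ 1) ∧ ∀ t θ, (∀ i, eval θ (G t i) = a i) →
      (Matrix.of fun i j => eval θ (pderiv j (G t i))).det ≠ 0 := by
  let F : τ → (ι → ℝ) → (ι → ℝ) := fun t θ i => eval θ (G t i)
  let F' : τ → (ι → ℝ) → ((ι → ℝ) →L[ℝ] (ι → ℝ)) := fun t θ => ContinuousLinearMap.pi fun i =>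
    ∑ j, (eval θ (pderiv j (G t i))) • (ContinuousLinearMap.proj j : (ι → ℝ) →L[ℝ] ℝ)
  have hF : ∀ t θ, HasFDerivAt (F t) (F' t θ) θ := fun t θ =>
    hasFDerivAt_pi.2 fun i => mvp_hasFDerivAt (G t i) θ
  have hdet : ∀ t θ, (F' t θ).det = (Matrix.of fun i j => eval θ (pderiv j (G t i))).det := by
    intro t θ
    rw [ContinuousLinearMap.det, ← LinearMap.det_toLin']
    congr 1
    ext v i
    simp [F', Matrix.mulVec, dotProduct, Pi.single_apply]
  have hnull : MeasureTheory.volume (⋃ t, F t '' {θ | (F' t θ).det = 0}) = 0 := by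
    rw [MeasureTheory.measure_iUnion_null_iff]
    intro t
    exact MeasureTheory.addHaar_image_eq_zero_of_det_fderivWithin_eq_zero _
      (fun x _ => (hF t x).hasFDerivWithinAt) (fun x hx => hx)
  have hpos : 0 < MeasureTheory.volume (Metric.ball (0 : ι → ℝ) 1) :=
    Metric.measure_ball_pos _ _ one_pos
  obtain ⟨a, ha, ha'⟩ : ∃ a ∈ Metric.ball (0 : ι → ℝ) 1, a ∉ ⋃ t, F t '' {θ | (F' t θ).det = 0} := by
    by_contra hcon
    push Not at hcon
    have := MeasureTheory.measure_mono (μ := MeasureTheory.volume) (show Metric.ball (0 : ι → ℝ) 1 ⊆ _ from hcon)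
    rw [hnull] at this
    exact absurd this (not_le.2 hpos)
  refine ⟨a, fun j => ?_, fun t θ h => ?_⟩
  · have := (norm_le_pi_norm a j).trans (mem_ball_zero_iff.1 ha).le
    simpa using this
  · intro h0
    refine ha' (Set.mem_iUnion.2 ⟨t, θ, ?_, funext h⟩)
    change (F' t θ).det = 0
    rw [hdet]; exact h0

theorem hasDerivAt_max_sq (x : ℝ) : HasDerivAt (fun y : ℝ => (max 0 y) ^ 2) (2 * max 0 x) x := by
  rcases lt_trichotomy x 0 with h | h | h
  · rw [max_eq_left h.le, mul_zero]
    refine (hasDerivAt_const x (0:ℝ)).congr_of_eventuallyEq ?_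
    filter_upwards [Iio_mem_nhds h] with y hy
    rw [max_eq_left (le_of_lt hy)]; norm_num
  · subst h
    rw [max_self, mul_zero]
    rw [hasDerivAt_iff_isLittleO]
    simp only [max_self, sub_zero, smul_zero]
    have h1 : (fun y : ℝ => (max 0 y) ^ 2 - 0 ^ 2) =O[nhds 0] fun y : ℝ => y ^ 2 := by
      refine Asymptotics.IsBigO.of_bound 1 (Filter.Eventually.of_forall fun y => ?_)
      simp only [Real.norm_eq_abs, one_mul]
      rw [zero_pow (by norm_num), sub_zero, abs_of_nonneg (by positivity), abs_of_nonneg (by positivity)]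
      rcases le_total 0 y with hy | hy
      · rw [max_eq_right hy]
      · rw [max_eq_left hy, zero_pow (by norm_num)]; positivity
    refine h1.trans_isLittleO ?_
    simpa using Asymptotics.isLittleO_pow_pow (𝕜 := ℝ) (m := 1) (n := 2) (by norm_num)
  · rw [max_eq_right h.le]
    refine HasDerivAt.congr_of_eventuallyEq (f := fun y => y ^ 2) (by simpa using hasDerivAt_pow 2 x) ?_
    filter_upwards [Ioi_mem_nhds h] with y hy
    rw [max_eq_right (le_of_lt hy)]

theorem penalty_min {ι κ : Type*} [Fintype ι] [DecidableEq ι] [Fintype κ]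
    (f : κ → MvPolynomial ι ℝ) (c s : κ → ℝ) (hs : ∀ i, s i * s i = 1) (η K : ℝ) (hK : 0 ≤ K) (a : ι → ℝ) :
    ∃ θ : ι → ℝ,
      (∀ θ', ∑ j, (θ j - a j) ^ 2 + K * ∑ i, (max 0 (η - s i * (eval θ (f i) - c i))) ^ 2
        ≤ ∑ j, (θ' j - a j) ^ 2 + K * ∑ i, (max 0 (η - s i * (eval θ' (f i) - c i))) ^ 2) ∧
      ∀ j, θ j + K * ∑ i with 0 < η - s i * (eval θ (f i) - c i),
        (eval θ (f i) - (c i + s i * η)) * eval θ (pderiv j (f i)) = a j := by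
  let P : (ι → ℝ) → ℝ := fun θ =>
    ∑ j, (θ j - a j) ^ 2 + K * ∑ i, (max 0 (η - s i * (eval θ (f i) - c i))) ^ 2
  have hfc : ∀ i, Continuous fun θ : ι → ℝ => eval θ (f i) := fun i => (mvp_contDiff (f i)).continuous
  have hP : Continuous P := by
    have := hfc
    fun_prop
  obtain ⟨θ, hθ⟩ : ∃ θ, ∀ θ', P θ ≤ P θ' := by
    refine hP.exists_forall_le' a ?_
    have hc : (Metric.closedBall a (P a + 1))ᶜ ∈ Filter.cocompact (ι → ℝ) :=
      (isCompact_closedBall _ _).compl_mem_cocompact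
    have hPa : 0 ≤ P a := by simp only [P]; positivity
    filter_upwards [hc] with x hx
    have h1 : ∃ j, P a + 1 < |x j - a j| := by
      by_contra hcon
      push Not at hcon
      refine hx (mem_closedBall_iff_norm.2 ?_)
      rw [pi_norm_le_iff_of_nonneg (by linarith)]
      exact hcon
    obtain ⟨j, hj⟩ := h1
    have h2 : (x j - a j) ^ 2 ≤ ∑ j, (x j - a j) ^ 2 :=
      Finset.single_le_sum (f := fun j => (x j - a j) ^ 2) (fun _ _ => sq_nonneg _) (Finset.mem_univ j)
    have h3 : P a ≤ (x j - a j) ^ 2 := by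
      rw [← sq_abs]; nlinarith
    have h4 : 0 ≤ K * ∑ i, (max 0 (η - s i * (eval x (f i) - c i))) ^ 2 := by positivity
    simp only [P] at h3 ⊢
    linarith
  refine ⟨θ, hθ, fun j => ?_⟩
  let L : ℝ → (ι → ℝ) := fun t => θ + t • Pi.single j 1
  have hL : HasDerivAt L (Pi.single j 1) 0 := by
    have := ((hasDerivAt_id (0:ℝ)).smul_const (Pi.single j (1:ℝ) : ι → ℝ)).const_add θ
    rw [one_smul] at this
    exact this
  have hL0 : L 0 = θ := by simp [L]
  have hLk : ∀ k, HasDerivAt (fun t => L t k) ((Pi.single j 1 : ι → ℝ) k) 0 := fun k => hasDerivAt_pi.1 hL k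
  have hf : ∀ i, HasDerivAt (fun t => eval (L t) (f i)) (eval θ (pderiv j (f i))) 0 := by
    intro i
    have h1 := mvp_hasFDerivAt (f i) (L 0)
    have h2 := h1.comp_hasDerivAt 0 hL
    simpa [Pi.single_apply, hL0, Function.comp_def] using h2
  have hv : ∀ i, HasDerivAt (fun t => (max 0 (η - s i * (eval (L t) (f i) - c i))) ^ 2)
      (2 * max 0 (η - s i * (eval θ (f i) - c i)) * (-(s i * eval θ (pderiv j (f i))))) 0 := by
    intro i
    have h1 : HasDerivAt (fun t => η - s i * (eval (L t) (f i) - c i)) (-(s i * eval θ (pderiv j (f i)))) 0 :=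
      (((hf i).sub_const (c i)).const_mul (s i)).const_sub η
    have h2 := (hasDerivAt_max_sq (η - s i * (eval (L 0) (f i) - c i))).comp (0:ℝ) h1
    rw [hL0] at h2
    exact h2
  have hq : ∀ k, HasDerivAt (fun t => (L t k - a k) ^ 2) (2 * (θ k - a k) * (Pi.single j 1 : ι → ℝ) k) 0 := by
    intro k
    have := ((hLk k).sub_const (a k)).fun_pow 2
    simpa [hL0] using this
  have hd : HasDerivAt (fun t => P (L t))
      (∑ k, 2 * (θ k - a k) * (Pi.single j 1 : ι → ℝ) k +
        K * ∑ i, (2 * max 0 (η - s i * (eval θ (f i) - c i)) * (-(s i * eval θ (pderiv j (f i)))))) 0 := by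
    exact (HasDerivAt.fun_sum fun k _ => hq k).add ((HasDerivAt.fun_sum fun i _ => hv i).const_mul K)
  have hmin : IsLocalMin (fun t => P (L t)) 0 := Filter.Eventually.of_forall fun t => by
    simp only [hL0]; exact hθ _
  have h0 := hmin.hasDerivAt_eq_zero hd
  have e1 : ∑ k, 2 * (θ k - a k) * (Pi.single j 1 : ι → ℝ) k = 2 * (θ j - a j) := by
    simp [Pi.single_apply]
  have e2 : ∑ i, (2 * max 0 (η - s i * (eval θ (f i) - c i)) * (-(s i * eval θ (pderiv j (f i)))))
      = 2 * ∑ i with 0 < η - s i * (eval θ (f i) - c i),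
        (eval θ (f i) - (c i + s i * η)) * eval θ (pderiv j (f i)) := by
    rw [Finset.sum_filter, Finset.mul_sum]
    refine Finset.sum_congr rfl fun i _ => ?_
    split_ifs with h
    · rw [max_eq_right h.le]
      linear_combination (2 * (eval θ (f i) - c i) * eval θ (pderiv j (f i))) * hs i
    · rw [max_eq_left (not_lt.1 h)]; ring
  rw [e1, e2] at h0
  linarith

/-- A Warren type bound for quadratic polynomials. -/
theorem warren_quadratic {ι κ : Type*} [Fintype ι] [DecidableEq ι] [Fintype κ] [DecidableEq κ]
    (g : κ → MvPolynomial ι ℝ) (hg : ∀ i, (g i).totalDegree ≤ 2)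
    (pt : Finset κ → (ι → ℝ)) (hpt : ∀ S i, 0 < eval (pt S) (g i) ↔ i ∈ S) :
    (2:ℝ) ^ Fintype.card κ ≤
      (27 / 4) ^ Fintype.card ι * (16 ^ Fintype.card ι * (9 / 8) ^ Fintype.card κ) := by
  set D := Fintype.card ι with hD
  -- a margin for the positive values
  obtain ⟨δ, hδ, hδ'⟩ : ∃ δ : ℝ, 0 < δ ∧ ∀ S, ∀ i ∈ S, δ ≤ eval (pt S) (g i) := by
    have : ∀ᶠ δ in nhdsWithin (0:ℝ) (Set.Ioi 0), ∀ S, ∀ i, i ∈ S → δ ≤ eval (pt S) (g i) := by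
      refine Filter.eventually_all.2 fun S => Filter.eventually_all.2 fun i => ?_
      by_cases hi : i ∈ S
      · filter_upwards [Ioo_mem_nhdsGT ((hpt S i).2 hi)] with δ hδ _
        exact hδ.2.le
      · exact Filter.Eventually.of_forall fun _ h => absurd h hi
    obtain ⟨δ, h1, h2⟩ := (this.and self_mem_nhdsWithin).exists
    exact ⟨δ, h2, h1⟩
  have hneg : ∀ S, ∀ i ∉ S, eval (pt S) (g i) ≤ 0 := fun S i hi =>
    not_lt.1 fun h => hi ((hpt S i).1 h)
  -- a bound on the points
  obtain ⟨R₀, hR₀⟩ : ∃ R₀ : ℝ, ∀ S j, |pt S j| ≤ R₀ := by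
    obtain ⟨R, hR⟩ := (Set.finite_range fun x : Finset κ × ι => |pt x.1 x.2|).bddAbove
    exact ⟨R, fun S j => hR ⟨(S, j), rfl⟩⟩
  set M : ℝ := ∑ _j : ι, (R₀ + 1) ^ 2 with hM
  have hM0 : 0 ≤ M := Finset.sum_nonneg fun _ _ => sq_nonneg _
  obtain ⟨c, hcU, hc⟩ := generic_levels g (M + 2) (Set.pi Set.univ fun _ => Set.Ioo (δ / 4) (3 * δ / 4))
    (isOpen_set_pi Set.finite_univ fun _ _ => isOpen_Ioo)
    ⟨fun _ => δ / 2, fun i _ => ⟨by linarith, by linarith⟩⟩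
  obtain ⟨η, hη, hηδ, hgap⟩ := generic_gap g (M + 2) c D (δ / 4) (by linarith) hc
  set K : ℝ := (M + 1) / η ^ 2 with hKdef
  have hK : 0 ≤ K := by positivity
  let s : Finset κ → κ → ℝ := fun S i => if i ∈ S then 1 else -1
  have hs : ∀ S i, s S i * s S i = 1 := by
    intro S i; simp only [s]; split_ifs <;> norm_num
  let G : Finset κ × Finset κ → ι → MvPolynomial ι ℝ := fun t j =>
    X j + C K * ∑ i ∈ t.1, (g i - C (c i + s t.2 i * η)) * pderiv j (g i)
  obtain ⟨a, ha, hreg⟩ := sard_family G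
  choose θ hmin hcrit using fun S => penalty_min g c (s S) (hs S) η K hK a
  let I : Finset κ → Finset κ := fun S =>
    Finset.univ.filter fun i => 0 < η - s S i * (eval (θ S) (g i) - c i)
  -- the value at the minimum is at most `M`
  have hval : ∀ S, ∑ j, (θ S j - a j) ^ 2 +
      K * ∑ i, (max 0 (η - s S i * (eval (θ S) (g i) - c i))) ^ 2 ≤ M := by
    intro S
    refine (hmin S (pt S)).trans ?_
    have h1 : ∀ i, max 0 (η - s S i * (eval (pt S) (g i) - c i)) = 0 := by
      intro i
      refine max_eq_left ?_
      have hci := hcU i (Set.mem_univ i)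
      simp only [Set.mem_Ioo] at hci
      by_cases hi : i ∈ S
      · have := hδ' S i hi
        simp only [s, if_pos hi]; linarith
      · have := hneg S i hi
        simp only [s, if_neg hi]; linarith
    simp only [h1]
    simp only [ne_eq, OfNat.ofNat_ne_zero, not_false_eq_true, zero_pow, Finset.sum_const_zero,
      mul_zero, add_zero]
    refine Finset.sum_le_sum fun j _ => ?_
    refine sq_le_sq' ?_ ?_
    · have := abs_le.1 (hR₀ S j); have := abs_le.1 (ha j); linarith
    · have := abs_le.1 (hR₀ S j); have := abs_le.1 (ha j); linarith
  have hball : ∀ S, θ S ∈ Metric.closedBall (0 : ι → ℝ) (M + 2) := by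
    intro S
    rw [mem_closedBall_zero_iff, pi_norm_le_iff_of_nonneg (by linarith)]
    intro j
    have h1 : (θ S j - a j) ^ 2 ≤ ∑ j, (θ S j - a j) ^ 2 :=
      Finset.single_le_sum (f := fun j => (θ S j - a j) ^ 2) (fun _ _ => sq_nonneg _) (Finset.mem_univ j)
    have h2 : 0 ≤ K * ∑ i, (max 0 (η - s S i * (eval (θ S) (g i) - c i))) ^ 2 := by positivity
    have h3 : (θ S j - a j) ^ 2 ≤ M := by have := hval S; linarith
    have h4 := abs_le.1 (ha j)
    have h5 : |θ S j - a j| ≤ M + 1 := by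
      refine abs_le_of_sq_le_sq ?_ (by linarith)
      nlinarith
    rw [Real.norm_eq_abs]
    have h6 := abs_le.1 h5
    exact abs_le.2 ⟨by linarith, by linarith⟩
  have hviol : ∀ S i, η - s S i * (eval (θ S) (g i) - c i) < η := by
    intro S i
    by_contra hcon
    push Not at hcon
    have h1 : η ^ 2 ≤ (max 0 (η - s S i * (eval (θ S) (g i) - c i))) ^ 2 :=
      pow_le_pow_left₀ hη.le (hcon.trans (le_max_right _ _)) 2
    have h2 := h1.trans (Finset.single_le_sum
      (f := fun i => (max 0 (η - s S i * (eval (θ S) (g i) - c i))) ^ 2)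
      (fun _ _ => sq_nonneg _) (Finset.mem_univ i))
    have h3 := mul_le_mul_of_nonneg_left h2 hK
    have h4 : K * η ^ 2 = M + 1 := by rw [hKdef]; field_simp
    have h5 : 0 ≤ ∑ j, (θ S j - a j) ^ 2 := Finset.sum_nonneg fun _ _ => sq_nonneg _
    have := hval S
    linarith
  have hI : ∀ S, (I S).card ≤ D := by
    intro S
    by_contra hcon
    push Not at hcon
    obtain ⟨i, hi, h⟩ := hgap (I S) hcon (θ S) (hball S)
    have h1 : 0 < η - s S i * (eval (θ S) (g i) - c i) := (Finset.mem_filter.1 hi).2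
    have h2 := hviol S i
    have h3 : |eval (θ S) (g i) - c i| = |s S i * (eval (θ S) (g i) - c i)| := by
      rw [abs_mul]
      simp only [s]; split_ifs <;> simp
    rw [h3] at h
    have h4 : |s S i * (eval (θ S) (g i) - c i)| < η := abs_lt.2 ⟨by linarith, by linarith⟩
    linarith
  -- counting
  let φ : Finset κ → Finset κ × Finset κ := fun S => (I S, S ∩ I S)
  have hsol : ∀ S j, eval (θ S) (G (φ S) j) = a j := by
    intro S j
    rw [← hcrit S j]
    simp only [G, φ, map_add, map_mul, map_sum, map_sub, eval_X, eval_C]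
    congr 2
    refine Finset.sum_congr rfl fun i hi => ?_
    have : s (S ∩ I S) i = s S i := by simp only [s, Finset.mem_inter, show i ∈ I S from hi, and_true]
    rw [this]
  have hdeg : ∀ t j, (G t j - C (a j)).totalDegree ≤ 3 := by
    intro t j
    refine (totalDegree_sub _ _).trans (max_le ?_ (by simp))
    refine (totalDegree_add _ _).trans (max_le (by simp) ?_)
    refine (totalDegree_mul _ _).trans ?_
    rw [totalDegree_C, zero_add]
    refine totalDegree_finsetSum_le fun i _ => (totalDegree_mul _ _).trans ?_
    have h1 := mvp_totalDegree_pderiv (g i) 1 (hg i) j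
    have h2 : (g i - C (c i + s t.2 i * η)).totalDegree ≤ 2 :=
      (totalDegree_sub _ _).trans (max_le (hg i) (by rw [totalDegree_C]; omega))
    omega
  have hinj : ∀ S S', φ S = φ S' → θ S = θ S' → S = S' := by
    intro S S' h1 h2
    have hII : I S = I S' := congrArg Prod.fst h1
    have hTT : S ∩ I S = S' ∩ I S' := congrArg Prod.snd h1
    have aux : ∀ S i, i ∉ I S → (i ∈ S ↔ 0 < eval (θ S) (g i) - c i) := by
      intro S i hi
      have h3 : ¬ 0 < η - s S i * (eval (θ S) (g i) - c i) := fun h =>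
        hi (Finset.mem_filter.2 ⟨Finset.mem_univ _, h⟩)
      by_cases hS : i ∈ S
      · simp only [s, if_pos hS] at h3
        exact ⟨fun _ => by linarith, fun _ => hS⟩
      · simp only [s, if_neg hS] at h3
        exact ⟨fun h => absurd h hS, fun h => by linarith⟩
    ext i
    by_cases hi : i ∈ I S
    · have := Finset.ext_iff.1 hTT i
      simpa [hi, ← hII] using this
    · rw [aux S i hi, aux S' i (by rwa [← hII]), h2]
  have hfib : ∀ t, (((Finset.univ.filter fun S => φ S = t).card : ℕ) : ℝ) ≤ (27 / 4) ^ D := by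
    intro t
    have h1 : (Finset.univ.filter fun S => φ S = t).card
        = ((Finset.univ.filter fun S => φ S = t).image θ).card := by
      refine (Finset.card_image_of_injOn ?_).symm
      intro S hS S' hS' h
      simp only [Finset.coe_filter, Finset.mem_univ, true_and, Set.mem_ofPred_eq] at hS hS'
      exact hinj S S' (hS.trans hS'.symm) h
    rw [h1]
    refine bezout_bound (fun j => G t j - C (a j)) (hdeg t) _ ?_ ?_
    · intro z hz i
      obtain ⟨S, hS, rfl⟩ := Finset.mem_image.1 hz
      have hS' := (Finset.mem_filter.1 hS).2
      rw [map_sub, eval_C, ← hS', hsol, sub_self]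
    · intro z hz
      obtain ⟨S, hS, rfl⟩ := Finset.mem_image.1 hz
      have hS' := (Finset.mem_filter.1 hS).2
      simp only [map_sub, pderiv_C, sub_zero]
      exact hreg t (θ S) fun i => by rw [← hS', hsol]
  have hcount : (Fintype.card (Finset κ) : ℝ) = ∑ t ∈ Finset.univ.image φ,
      (((Finset.univ.filter fun S => φ S = t).card : ℕ) : ℝ) := by
    rw [← Finset.card_univ, Finset.card_eq_sum_card_image φ]
    push_cast; rfl
  have himg : ((Finset.univ.image φ).card : ℝ) ≤ 16 ^ D * (9 / 8) ^ Fintype.card κ := by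
    let W : Finset (Σ _ : Finset κ, Finset κ) :=
      (Finset.univ.filter fun J : Finset κ => J.card ≤ D).sigma fun J => J.powerset
    have h1 : (Finset.univ.image φ).card ≤ W.card := by
      refine Finset.card_le_card_of_injOn (fun t => ⟨t.1, t.2⟩) ?_ ?_
      · intro t ht
        obtain ⟨S, _, rfl⟩ := Finset.mem_image.1 ht
        simp [W, φ, hI S]
      · rintro ⟨x, y⟩ _ ⟨x', y'⟩ _ h
        simpa using h
    have h2 : (W.card : ℝ) ≤ 16 ^ D * (9 / 8) ^ Fintype.card κ := by
      rw [Finset.card_sigma]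
      push_cast
      calc ∑ J : Finset κ with J.card ≤ D, ((J.powerset.card : ℕ) : ℝ)
          ≤ ∑ J : Finset κ with J.card ≤ D, 16 ^ D * (1 / 8 : ℝ) ^ J.card := by
            refine Finset.sum_le_sum fun J hJ => ?_
            have hJ' := (Finset.mem_filter.1 hJ).2
            rw [Finset.card_powerset]
            push_cast
            have h3 : (16:ℝ) ^ J.card ≤ 16 ^ D := pow_le_pow_right₀ (by norm_num) hJ'
            calc (2:ℝ) ^ J.card = 16 ^ J.card * (1 / 8) ^ J.card := by rw [← mul_pow]; norm_num
              _ ≤ _ := by gcongr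
        _ ≤ ∑ J : Finset κ, 16 ^ D * (1 / 8 : ℝ) ^ J.card :=
            Finset.sum_le_sum_of_subset_of_nonneg (Finset.filter_subset _ _) fun _ _ _ => by positivity
        _ = 16 ^ D * (9 / 8) ^ Fintype.card κ := by
            rw [← Finset.mul_sum]
            congr 1
            have := Fintype.sum_pow_mul_eq_add_pow κ (1 / 8 : ℝ) 1
            simp only [one_pow, mul_one] at this
            rw [this]; norm_num
    exact le_trans (by exact_mod_cast h1) h2
  calc (2:ℝ) ^ Fintype.card κ = (Fintype.card (Finset κ) : ℝ) := by simp
    _ ≤ ∑ t ∈ Finset.univ.image φ, (27 / 4 : ℝ) ^ D := by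
      rw [hcount]; exact Finset.sum_le_sum fun t _ => hfib t
    _ = (27 / 4 : ℝ) ^ D * (Finset.univ.image φ).card := by
      rw [Finset.sum_const, nsmul_eq_mul, mul_comm]
    _ ≤ _ := by gcongr

end Helpers

/-- **VC dimension of the Yatracos class of centered Gaussian densities with polynomially
parametrized inverse covariances** (covering the `n`-dimensional marginals of Gaussian AR(p)
sources). If each `Σ(θ)` is positive definite and every entry of `Σ(θ)⁻¹` is the restriction
to `Λ ⊆ ℝ^p` of a polynomial of degree at most `2` in `θ`, then the Yatracos class of the
densities `p_θ(xⁿ) = (2π)^{-n/2} (det Σ(θ))^{-1/2} exp(-(1/2) xᵀ Σ(θ)⁻¹ x)` is a VC class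
with VC dimension at most `(4p+4) log₂(8e)`. -/
theorem stmt_11 (n p : ℕ) (hn : 1 ≤ n) (hp : 1 ≤ p)
    (Λ : Set (Fin p → ℝ)) (Sig : (Fin p → ℝ) → Matrix (Fin n) (Fin n) ℝ)
    (hpos : ∀ θ ∈ Λ, (Sig θ).PosDef)
    (hpoly : ∀ i j : Fin n, ∃ q : MvPolynomial (Fin p) ℝ,
      q.totalDegree ≤ 2 ∧ ∀ θ ∈ Λ, (Sig θ)⁻¹ i j = MvPolynomial.eval θ q)
    (dens : (Fin p → ℝ) → (Fin n → ℝ) → ℝ)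
    (hdens : ∀ θ x, dens θ x =
      (2 * π) ^ (-(n : ℝ) / 2) * (Sig θ).det ^ (-(1 : ℝ) / 2) *
        Real.exp (-(1 / 2) * (x ⬝ᵥ (Sig θ)⁻¹.mulVec x)))
    (𝒜 : Set (Set (Fin n → ℝ)))
    (h𝒜 : 𝒜 = {A | ∃ θ ∈ Λ, ∃ θ' ∈ Λ, θ ≠ θ' ∧ A = {x | dens θ' x < dens θ x}}) :
    ∀ S : Finset (Fin n → ℝ), Shatters 𝒜 S →
      (S.card : ℝ) ≤ (4 * p + 4) * Real.logb 2 (8 * Real.exp 1) := by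
  classical
  intro S hS
  by_contra hcon
  push Not at hcon
  choose q hq hq' using hpoly
  -- the polynomials
  let g : S → MvPolynomial (Fin p ⊕ (Fin p ⊕ Unit)) ℝ := fun z =>
    (∑ i, ∑ j, MvPolynomial.C (z.1 i * z.1 j) *
      (MvPolynomial.rename (fun k => Sum.inr (Sum.inl k)) (q i j) -
        MvPolynomial.rename Sum.inl (q i j))) + MvPolynomial.X (Sum.inr (Sum.inr ()))
  have hg : ∀ z, (g z).totalDegree ≤ 2 := by
    intro z
    refine (MvPolynomial.totalDegree_add _ _).trans (max_le ?_ (by simp))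
    refine MvPolynomial.totalDegree_finsetSum_le fun i _ => ?_
    refine MvPolynomial.totalDegree_finsetSum_le fun j _ => ?_
    refine (MvPolynomial.totalDegree_mul _ _).trans ?_
    rw [MvPolynomial.totalDegree_C, zero_add]
    exact (MvPolynomial.totalDegree_sub _ _).trans (max_le
      ((MvPolynomial.totalDegree_rename_le _ _).trans (hq i j))
      ((MvPolynomial.totalDegree_rename_le _ _).trans (hq i j)))
  let par : (Fin p → ℝ) → (Fin p → ℝ) → (Fin p ⊕ (Fin p ⊕ Unit) → ℝ) := fun θ θ' =>
    Sum.elim θ (Sum.elim θ' fun _ => Real.log (Sig θ').det - Real.log (Sig θ).det)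
  have hquad : ∀ θ ∈ Λ, ∀ x : Fin n → ℝ, x ⬝ᵥ (Sig θ)⁻¹.mulVec x =
      ∑ i, ∑ j, x i * x j * MvPolynomial.eval θ (q i j) := by
    intro θ hθ x
    simp only [dotProduct, Matrix.mulVec, Finset.mul_sum]
    refine Finset.sum_congr rfl fun i _ => Finset.sum_congr rfl fun j _ => ?_
    rw [hq' i j θ hθ]; ring
  have heval : ∀ θ ∈ Λ, ∀ θ' ∈ Λ, ∀ z : S, MvPolynomial.eval (par θ θ') (g z) =
      (z.1 ⬝ᵥ (Sig θ')⁻¹.mulVec z.1 - z.1 ⬝ᵥ (Sig θ)⁻¹.mulVec z.1) +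
        (Real.log (Sig θ').det - Real.log (Sig θ).det) := by
    intro θ hθ θ' hθ' z
    rw [hquad θ hθ, hquad θ' hθ']
    simp only [g, map_add, map_sum, map_mul, map_sub, MvPolynomial.eval_C, MvPolynomial.eval_X,
      MvPolynomial.eval_rename, ← Finset.sum_sub_distrib, mul_sub]
    congr 1
  have hd : ∀ θ ∈ Λ, ∀ x, dens θ x = (2 * π) ^ (-(n : ℝ) / 2) *
      Real.exp (-(1 / 2) * (Real.log (Sig θ).det + x ⬝ᵥ (Sig θ)⁻¹.mulVec x)) := by
    intro θ hθ x
    rw [hdens, Real.rpow_def_of_pos (hpos θ hθ).det_pos, mul_assoc, ← Real.exp_add]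
    congr 2; ring
  have hlt : ∀ θ ∈ Λ, ∀ θ' ∈ Λ, ∀ z : S,
      (0 < MvPolynomial.eval (par θ θ') (g z) ↔ dens θ' z.1 < dens θ z.1) := by
    intro θ hθ θ' hθ' z
    have hA : (0:ℝ) < (2 * π) ^ (-(n : ℝ) / 2) := Real.rpow_pos_of_pos (by positivity) _
    rw [hd θ hθ, hd θ' hθ', mul_lt_mul_iff_right₀ hA, Real.exp_lt_exp, heval θ hθ θ' hθ']
    constructor <;> intro h <;> linarith
  have hex : ∀ B : Finset S, ∃ y : (Fin p ⊕ (Fin p ⊕ Unit) → ℝ),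
      ∀ z, 0 < MvPolynomial.eval y (g z) ↔ z ∈ B := by
    intro B
    obtain ⟨A, hA, hAB⟩ := hS (B.map (Function.Embedding.subtype _)) (by
      intro z hz
      obtain ⟨w, _, rfl⟩ := Finset.mem_map.1 hz
      exact w.2)
    rw [h𝒜] at hA
    obtain ⟨θ, hθ, θ', hθ', _, rfl⟩ := hA
    refine ⟨par θ θ', fun z => ?_⟩
    rw [hlt θ hθ θ' hθ' z]
    have := hAB z.1 z.2
    simpa using this
  choose pt hpt using hex
  have hw := warren_quadratic g hg pt hpt
  have hcard : Fintype.card (Fin p ⊕ (Fin p ⊕ Unit)) = 2 * p + 1 := by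
    simp; ring
  rw [hcard, Fintype.card_coe] at hw
  set m := S.card with hm
  -- numerics
  have hlog : (17 / 4 : ℝ) ≤ Real.logb 2 (8 * Real.exp 1) := by
    rw [Real.le_logb_iff_rpow_le (by norm_num) (by positivity)]
    have he := Real.exp_one_gt_d9
    have h1 : ((2:ℝ) ^ (17 / 4 : ℝ)) ^ 4 ≤ (8 * Real.exp 1) ^ 4 := by
      rw [← Real.rpow_natCast, ← Real.rpow_mul (by norm_num)]
      have h2 : (21:ℝ) ^ 4 ≤ (8 * Real.exp 1) ^ 4 :=
        pow_le_pow_left₀ (by norm_num) (by linarith) 4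
      have h3 : (2:ℝ) ^ ((17 / 4 : ℝ) * ((4:ℕ):ℝ)) = 2 ^ 17 := by
        rw [show (17 / 4 : ℝ) * ((4:ℕ):ℝ) = ((17:ℕ):ℝ) by norm_num, Real.rpow_natCast]
      rw [h3]
      refine le_trans ?_ h2
      norm_num
    exact le_of_pow_le_pow_left₀ (by norm_num) (by positivity) h1
  have hm1 : (17 * (p + 1) : ℝ) < m := by
    refine lt_of_le_of_lt ?_ hcon
    have : (0:ℝ) ≤ 4 * p + 4 := by positivity
    nlinarith
  have hm2 : 17 * (p + 1) ≤ m := by exact_mod_cast hm1.le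
  have h1 : (16 / 9 : ℝ) ^ m ≤ 108 ^ (2 * p + 1) := by
    have e : (2:ℝ) ^ m = (16 / 9) ^ m * (9 / 8) ^ m := by rw [← mul_pow]; norm_num
    rw [← mul_assoc, ← mul_pow, e] at hw
    have h9 : (0:ℝ) < (9 / 8) ^ m := by positivity
    have := le_of_mul_le_mul_right hw h9
    norm_num at this ⊢
    exact this
  have h2 : (16 / 9 : ℝ) ^ (17 * (p + 1)) ≤ (16 / 9) ^ m := pow_le_pow_right₀ (by norm_num) hm2
  have h3 : (108:ℝ) ^ (2 * p + 1) ≤ 108 ^ (2 * (p + 1)) := pow_le_pow_right₀ (by norm_num) (by omega)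
  have h4 : (108:ℝ) ^ (2 * (p + 1)) < (16 / 9 : ℝ) ^ (17 * (p + 1)) := by
    rw [pow_mul, pow_mul]
    exact pow_lt_pow_left₀ (by norm_num) (by norm_num) (by omega)
  linarith
end

section
/- Let M ≥ 1, n ≥ 2, let π = (π₁, …, π_M) be a probability vector, and let p(·|s), s ∈ {1, …, M}, be fixed probability densities on ℝ^d. For θ = [a_{ij}] ∈ ℝ^{M×M} define the density on (ℝ^d)ⁿ by p_θ(xⁿ) = Σ_{sⁿ ∈ {1,…,M}ⁿ} π_{s₁} p(x₁|s₁) ∏_{i=2}^n a_{s_{i−1} s_i} p(x_i|s_i). Then the Yatracos class 𝒜_n = { { xⁿ ∈ (ℝ^d)ⁿ : p_θ(xⁿ) > p_{θ'}(xⁿ) } : θ ≠ θ' } is a VC class with VC dimension at most 4 M² log₂(4 e n). -/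
open MeasureTheory

/-- The `n`-dimensional output density of a hidden Markov process with `M` states, initial
distribution `pi0`, transition matrix `a`, and channel transition densities `pch`:
`p_θ(xⁿ) = Σ_{sⁿ} π_{s₁} p(x₁|s₁) ∏_{i=2}^n a_{s_{i-1}s_i} p(x_i|s_i)`. -/
noncomputable def hmmDensity (M n d : ℕ) (hn : 0 < n) (pi0 : Fin M → ℝ)
    (pch : Fin M → (Fin d → ℝ) → ℝ) (a : Fin M → Fin M → ℝ)
    (x : Fin n → Fin d → ℝ) : ℝ :=
  ∑ s : Fin n → Fin M,
    pi0 (s ⟨0, hn⟩) * (∏ i, pch (s i) (x i)) *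
      ∏ i : Fin n, if h : (i : ℕ) + 1 < n then a (s i) (s ⟨(i : ℕ) + 1, h⟩) else 1

set_option linter.all false

namespace HmmVC
open MvPolynomial Filter Topology
open scoped Pointwise

lemma interp {τ : Type*} (Z : Finset (τ → ℝ)) (z : τ → ℝ) :
    ∃ h : MvPolynomial τ ℝ, eval z h = 1 ∧ ∀ z' ∈ Z, z' ≠ z → eval z' h = 0 := by
  classical
  induction Z using Finset.induction_on with
  | empty => exact ⟨1, by simp⟩
  | insert w Z hw ih =>
    obtain ⟨h, h1, h2⟩ := ih
    by_cases hwz : w = z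
    · refine ⟨h, h1, fun z' hz' hne => ?_⟩
      rcases Finset.mem_insert.1 hz' with rfl | h'
      · exact absurd hwz hne
      · exact h2 _ h' hne
    · obtain ⟨i, hi⟩ : ∃ i, w i ≠ z i := by
        by_contra! hc
        exact hwz (funext hc)
      refine ⟨h * (C (1 / (z i - w i)) * (X i - C (w i))), ?_, fun z' hz' hne => ?_⟩
      · have : z i - w i ≠ 0 := sub_ne_zero.2 (Ne.symm hi)
        simp [h1, this]
      · rcases Finset.mem_insert.1 hz' with rfl | h'
        · simp
        · simp [h2 _ h' hne]

def degSet (τ : Type*) [Fintype τ] (T : ℕ) : Set (τ →₀ ℕ) := {γ | ∑ i, γ i ≤ T}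

lemma ncard_degSet (τ : Type*) [Fintype τ] (T : ℕ) :
    Nat.card (degSet τ T) = (T + Fintype.card τ).choose (Fintype.card τ) := by
  classical
  have h := Finset.card_finsuppAntidiag_nat_eq_choose (s := (Finset.univ : Finset (Option τ))) T
  have e : degSet τ T ≃ Finset.finsuppAntidiag (Finset.univ : Finset (Option τ)) T :=
    { toFun := fun γ => ⟨Finsupp.equivFunOnFinite.symm
          (fun o => o.elim (T - ∑ i, γ.1 i) (fun i => γ.1 i)), by
        have := γ.2
        simp only [degSet, Set.mem_ofPred_eq] at this
        simp [Finset.mem_finsuppAntidiag, Fintype.sum_option]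
        omega⟩
      invFun := fun γ => ⟨γ.1.some, by
        have := (Finset.mem_finsuppAntidiag.1 γ.2).1
        rw [Fintype.sum_option] at this
        simp [degSet]
        omega⟩
      left_inv := fun γ => by
        ext i
        simp
      right_inv := fun γ => by
        have := (Finset.mem_finsuppAntidiag.1 γ.2).1
        rw [Fintype.sum_option] at this
        ext o
        cases o with
        | none => simp; omega
        | some i => simp }
  rw [Nat.card_congr e, Nat.card_eq_fintype_card, Fintype.card_coe, h]
  simp only [Finset.card_univ, Fintype.card_option]
  rw [show Fintype.card τ + 1 + T - 1 = T + Fintype.card τ by omega]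
  rw [← Nat.choose_symm_add]

instance (τ : Type*) [Fintype τ] (T : ℕ) : Finite (degSet τ T) := by
  apply Nat.finite_of_card_ne_zero
  rw [ncard_degSet]
  exact (Nat.choose_pos (by omega)).ne'

variable {σ ι : Type*} [Fintype σ] [Fintype ι]

def biSet (σ ι : Type*) [Fintype σ] [Fintype ι] (a b : ℕ) : Set (σ ⊕ ι →₀ ℕ) :=
  {γ | ∑ i, γ (Sum.inl i) ≤ a ∧ ∑ j, γ (Sum.inr j) ≤ b}

noncomputable def biEquiv (a b : ℕ) : biSet σ ι a b ≃ degSet σ a × degSet ι b where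
  toFun γ := (⟨(Finsupp.sumFinsuppEquivProdFinsupp γ.1).1, by
      have := γ.2.1; simpa [degSet] using this⟩,
    ⟨(Finsupp.sumFinsuppEquivProdFinsupp γ.1).2, by
      have := γ.2.2; simpa [degSet] using this⟩)
  invFun p := ⟨Finsupp.sumFinsuppEquivProdFinsupp.symm (p.1.1, p.2.1), by
    have h1 := p.1.2
    have h2 := p.2.2
    simp only [degSet, Set.mem_ofPred_eq] at h1 h2
    simpa [biSet] using ⟨h1, h2⟩⟩
  left_inv γ := by simp
  right_inv p := by ext <;> simp

lemma ncard_biSet (a b : ℕ) : Nat.card (biSet σ ι a b) =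
    (a + Fintype.card σ).choose (Fintype.card σ) * (b + Fintype.card ι).choose (Fintype.card ι) := by
  rw [Nat.card_congr (biEquiv a b), Nat.card_prod, ncard_degSet, ncard_degSet]

instance (a b : ℕ) : Finite (biSet σ ι a b) := Finite.of_equiv _ (biEquiv a b).symm

noncomputable abbrev Bd (σ ι : Type*) [Fintype σ] [Fintype ι] (a b : ℕ) : Submodule ℝ (MvPolynomial (σ ⊕ ι) ℝ) :=
  restrictSupport ℝ (biSet σ ι a b)

lemma Bd_mono {a b a' b' : ℕ} (ha : a ≤ a') (hb : b ≤ b') : Bd σ ι a b ≤ Bd σ ι a' b' :=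
  restrictSupport_mono _ (fun _ h => ⟨h.1.trans ha, h.2.trans hb⟩)

lemma Bd_mul {a b a' b' : ℕ} {p q : MvPolynomial (σ ⊕ ι) ℝ} (hp : p ∈ Bd σ ι a b)
    (hq : q ∈ Bd σ ι a' b') : p * q ∈ Bd σ ι (a + a') (b + b') := by
  have h : p * q ∈ restrictSupport ℝ (biSet σ ι a b + biSet σ ι a' b') := by
    rw [restrictSupport_add]
    exact Submodule.mul_mem_mul hp hq
  refine restrictSupport_mono _ ?_ h
  rintro _ ⟨x, hx, y, hy, rfl⟩
  constructor
  · simpa [Finset.sum_add_distrib] using add_le_add hx.1 hy.1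
  · simpa [Finset.sum_add_distrib] using add_le_add hx.2 hy.2

lemma Bd_C (a b : ℕ) (c : ℝ) : C c ∈ Bd σ ι a b := by
  rw [C_apply, monomial_mem_restrictSupport]
  left
  simp [biSet]

lemma Bd_pow {a b : ℕ} {p : MvPolynomial (σ ⊕ ι) ℝ} (hp : p ∈ Bd σ ι a b) (r : ℕ) :
    p ^ r ∈ Bd σ ι (a * r) (b * r) := by
  induction r with
  | zero => simpa using Bd_C (σ := σ) (ι := ι) 0 0 1
  | succ r ih => 
    rw [pow_succ, mul_add, mul_add, mul_one, mul_one]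
    exact Bd_mul ih hp

lemma Bd_prod {D : ℕ} {τ : Type*} (s : Finset τ) (G : τ → MvPolynomial (σ ⊕ ι) ℝ) (r : τ → ℕ)
    (hG : ∀ t, G t ∈ Bd σ ι D 1) :
    ∏ t ∈ s, G t ^ r t ∈ Bd σ ι (D * ∑ t ∈ s, r t) (∑ t ∈ s, r t) := by
  classical
  induction s using Finset.induction_on with
  | empty => simpa using Bd_C (σ := σ) (ι := ι) 0 0 1
  | insert a s ha ih =>
    rw [Finset.prod_insert ha, Finset.sum_insert ha, mul_add]
    have := Bd_pow (hG a) (r a)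
    rw [one_mul] at this
    exact Bd_mul this ih

lemma Bd_aeval {D T : ℕ} (G : σ ⊕ ι → MvPolynomial (σ ⊕ ι) ℝ) (hG : ∀ t, G t ∈ Bd σ ι D 1)
    (P : MvPolynomial (σ ⊕ ι) ℝ) (hP : P ∈ restrictSupport ℝ (degSet (σ ⊕ ι) T)) :
    aeval G P ∈ Bd σ ι (D * T) T := by
  rw [aeval_def, eval₂_eq']
  refine Submodule.sum_mem _ fun γ hγ => ?_
  have h1 : ∑ i, γ i ≤ T := (mem_restrictSupport_iff ℝ).1 hP hγ
  rw [algebraMap_eq, ← smul_eq_C_mul]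
  exact Submodule.smul_mem _ _ (Bd_mono (Nat.mul_le_mul_left _ h1) h1 (Bd_prod _ G _ hG))

lemma Bd_all {D : ℕ} (hD : 1 ≤ D) (p : MvPolynomial (σ ⊕ ι) ℝ) :
    ∃ e, ∀ e' ≥ e, p ∈ Bd σ ι (D * e') e' := by
  refine ⟨p.totalDegree, fun e' he => ?_⟩
  rw [mem_restrictSupport_iff]
  intro γ hγ
  have h := le_totalDegree (Finset.mem_coe.1 hγ)
  rw [Finsupp.sum_fintype _ _ (fun _ => rfl), Fintype.sum_sum_type] at h
  have : e' ≤ D * e' := Nat.le_mul_of_pos_left _ hD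
  constructor <;> omega

lemma indep {τ : Type*} [Fintype τ] (G : τ → MvPolynomial τ ℝ) (Z : Finset (τ → ℝ))
    (hz : ∀ z ∈ Z, ∀ t, eval z (G t) = 0)
    (hnd : ∀ z ∈ Z, ∃ A : (τ → ℝ) →L[ℝ] (τ → ℝ), Function.Surjective A ∧
      HasFDerivAt (fun z t => eval z (G t)) A z)
    (h : Z → MvPolynomial τ ℝ) (h1 : ∀ z : Z, eval z.1 (h z) = 1)
    (h0 : ∀ z z' : Z, z ≠ z' → eval z.1 (h z') = 0)
    (P : Z → MvPolynomial τ ℝ) (hP : ∑ z, h z * aeval G (P z) = 0) : P = 0 := by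
  classical
  by_contra hne
  have hex : ∃ r, ∃ z, ∃ γ, coeff γ (P z) ≠ 0 ∧ ∑ t, γ t = r := by
    obtain ⟨z, hz⟩ := Function.ne_iff.1 hne
    obtain ⟨γ, hγ⟩ := MvPolynomial.ne_zero_iff.1 hz
    exact ⟨_, z, γ, hγ, rfl⟩
  obtain ⟨z, γ₀, hγ₀, hr⟩ := Nat.find_spec hex
  have hmin : ∀ z' γ, coeff γ (P z') ≠ 0 → Nat.find hex ≤ ∑ t, γ t :=
    fun z' γ hc => Nat.find_min' hex ⟨z', γ, hc, rfl⟩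
  set r := Nat.find hex with hrdef
  clear_value r
  obtain ⟨A, hA, hder⟩ := hnd z.1 z.2
  have key : ∀ u : τ → ℝ, ∑ γ ∈ (P z).support,
      coeff γ (P z) * ((0 : ℝ) ^ (∑ t, γ t - r) * ∏ t, (A u t) ^ γ t) = 0 := by
    intro u
    have hsl : Tendsto (fun s : ℝ => s⁻¹ • ((fun t => eval (z.1 + s • u) (G t)) -
        (fun t => eval z.1 (G t)))) (𝓝[≠] 0) (𝓝 (A u)) :=
      (hder.hasLineDerivAt u).tendsto_slope_zero
    have hsl' : ∀ t, Tendsto (fun s : ℝ => s⁻¹ * eval (z.1 + s • u) (G t)) (𝓝[≠] 0)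
        (𝓝 (A u t)) := by
      intro t
      have := (tendsto_pi_nhds.1 hsl) t
      simpa [hz z.1 z.2] using this
    have hid : Tendsto (fun s : ℝ => s) (𝓝[≠] 0) (𝓝 0) := tendsto_nhdsWithin_of_tendsto_nhds tendsto_id
    have hh : ∀ z' : Z, Tendsto (fun s : ℝ => eval (z.1 + s • u) (h z')) (𝓝[≠] 0)
        (𝓝 (eval z.1 (h z'))) := by
      intro z'
      have hc : Continuous (fun s : ℝ => eval (z.1 + s • u) (h z')) :=
        (MvPolynomial.continuous_eval (h z')).comp (by fun_prop)
      have := hc.tendsto 0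
      simp only [zero_smul, add_zero] at this
      exact tendsto_nhdsWithin_of_tendsto_nhds this
    have hlim : Tendsto (fun s : ℝ => ∑ z', eval (z.1 + s • u) (h z') *
        ∑ γ ∈ (P z').support, coeff γ (P z') * (s ^ (∑ t, γ t - r) *
          ∏ t, (s⁻¹ * eval (z.1 + s • u) (G t)) ^ γ t)) (𝓝[≠] 0)
        (𝓝 (∑ z', eval z.1 (h z') * ∑ γ ∈ (P z').support, coeff γ (P z') *
          ((0 : ℝ) ^ (∑ t, γ t - r) * ∏ t, (A u t) ^ γ t))) := by
      refine tendsto_finsetSum _ fun z' _ => (hh z').mul ?_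
      refine tendsto_finsetSum _ fun γ _ => tendsto_const_nhds.mul ?_
      refine (hid.pow _).mul ?_
      exact tendsto_finsetProd _ fun t _ => (hsl' t).pow _
    have hzero : (fun s : ℝ => ∑ z', eval (z.1 + s • u) (h z') *
        ∑ γ ∈ (P z').support, coeff γ (P z') * (s ^ (∑ t, γ t - r) *
          ∏ t, (s⁻¹ * eval (z.1 + s • u) (G t)) ^ γ t)) =ᶠ[𝓝[≠] 0] fun _ => (0 : ℝ) := by
      filter_upwards [self_mem_nhdsWithin] with s hs
      have hs : s ≠ 0 := hs
      have h3 := congrArg (eval (z.1 + s • u)) hP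
      simp only [map_sum, map_mul, map_zero] at h3
      have h4 : ∀ z' : Z, eval (z.1 + s • u) (aeval G (P z')) =
          s ^ r * ∑ γ ∈ (P z').support, coeff γ (P z') * (s ^ (∑ t, γ t - r) *
          ∏ t, (s⁻¹ * eval (z.1 + s • u) (G t)) ^ γ t) := by
        intro z'
        rw [aeval_def, eval₂_eq', map_sum, Finset.mul_sum]
        refine Finset.sum_congr rfl fun γ hγ => ?_
        have hle := hmin z' γ (mem_support_iff.1 hγ)
        simp only [map_mul, map_prod, map_pow, algebraMap_eq, eval_C, mul_pow,
          Finset.prod_mul_distrib, Finset.prod_pow_eq_pow_sum]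
        have : s ^ r * (s ^ (∑ t, γ t - r) * s⁻¹ ^ (∑ t, γ t)) = 1 := by
          rw [← mul_assoc, ← pow_add, Nat.add_sub_cancel' hle, ← mul_pow, mul_inv_cancel₀ hs, one_pow]
        linear_combination (-(coeff γ (P z') * ∏ t, (eval (z.1 + s • u) (G t)) ^ γ t)) * this
      simp only [h4] at h3
      have h5 : s ^ r * ∑ z', eval (z.1 + s • u) (h z') *
        ∑ γ ∈ (P z').support, coeff γ (P z') * (s ^ (∑ t, γ t - r) *
          ∏ t, (s⁻¹ * eval (z.1 + s • u) (G t)) ^ γ t) = 0 := by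
        rw [← h3, Finset.mul_sum]
        exact Finset.sum_congr rfl fun _ _ => by ring
      exact (mul_eq_zero.1 h5).resolve_left (pow_ne_zero _ hs)
    have hfin := tendsto_nhds_unique (hlim.congr' hzero) tendsto_const_nhds
    rw [Finset.sum_eq_single z (fun z' _ hne => by rw [h0 z z' hne.symm, zero_mul])
      (fun hn => absurd (Finset.mem_univ _) hn), h1, one_mul] at hfin
    exact hfin
  have hQ : (∑ γ ∈ (P z).support, monomial γ (coeff γ (P z) * (0 : ℝ) ^ (∑ t, γ t - r))) = 0 := by
    apply MvPolynomial.funext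
    intro y
    obtain ⟨u, rfl⟩ := hA y
    rw [map_sum, map_zero]
    refine Eq.trans ?_ (key u)
    refine Finset.sum_congr rfl fun γ _ => ?_
    rw [eval_monomial, Finsupp.prod_fintype _ _ (fun _ => pow_zero _)]
    ring
  have hc := congrArg (coeff γ₀) hQ
  simp [coeff_sum, coeff_monomial, hr] at hc
  exact hγ₀ hc

lemma bez_count {D : ℕ} (hD : 1 ≤ D) (G : σ ⊕ ι → MvPolynomial (σ ⊕ ι) ℝ)
    (hG : ∀ t, G t ∈ Bd σ ι D 1) (Z : Finset (σ ⊕ ι → ℝ))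
    (hz : ∀ z ∈ Z, ∀ t, eval z (G t) = 0)
    (hnd : ∀ z ∈ Z, ∃ A : (σ ⊕ ι → ℝ) →L[ℝ] (σ ⊕ ι → ℝ), Function.Surjective A ∧
      HasFDerivAt (fun z t => eval z (G t)) A z) :
    ∃ e : ℕ, ∀ T : ℕ, Z.card * (T + (Fintype.card σ + Fintype.card ι)).choose
        (Fintype.card σ + Fintype.card ι) ≤
      (D * (T + e) + Fintype.card σ).choose (Fintype.card σ) *
        ((T + e) + Fintype.card ι).choose (Fintype.card ι) := by
  classical
  choose h h1 h0 using fun z : Z => interp Z z.1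
  choose e₀ he₀ using fun z : Z => Bd_all (σ := σ) (ι := ι) hD (h z)
  refine ⟨∑ z, e₀ z, fun T => ?_⟩
  set e := ∑ z, e₀ z with he
  have hh : ∀ z, h z ∈ Bd σ ι (D * e) e := fun z =>
    he₀ z e (Finset.single_le_sum (f := e₀) (fun _ _ => Nat.zero_le _) (Finset.mem_univ z))
  let V := restrictSupport ℝ (degSet (σ ⊕ ι) T)
  let Φ₀ : (Z → V) →ₗ[ℝ] MvPolynomial (σ ⊕ ι) ℝ :=
    ∑ z, (LinearMap.mulLeft ℝ (h z)) ∘ₗ (aeval G).toLinearMap ∘ₗ V.subtype ∘ₗ LinearMap.proj z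
  have hΦ₀ : ∀ P, Φ₀ P = ∑ z, h z * aeval G (P z).1 := by
    intro P
    simp [Φ₀, LinearMap.sum_apply]
  let Φ : (Z → V) →ₗ[ℝ] Bd σ ι (D * (T + e)) (T + e) := Φ₀.codRestrict _ (by
    intro P
    rw [hΦ₀]
    refine Submodule.sum_mem _ fun z _ => ?_
    have := Bd_mul (hh z) (Bd_aeval G hG (P z).1 (P z).2)
    exact Bd_mono (le_of_eq (by ring)) (le_of_eq (by ring)) this)
  have hinj : Function.Injective Φ := by
    rw [← LinearMap.ker_eq_bot, LinearMap.ker_eq_bot']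
    intro P hP
    have h2 : Φ₀ P = 0 := congrArg Subtype.val hP
    rw [hΦ₀] at h2
    have := indep G Z hz hnd h h1
      (fun z z' hne => h0 z' z.1 z.2 (fun hc => hne (Subtype.ext hc))) (fun z => (P z).1) h2
    funext z
    exact Subtype.ext (congrFun this z)
  have b1 := basisRestrictSupport ℝ (degSet (σ ⊕ ι) T)
  have b2 := basisRestrictSupport ℝ (biSet σ ι (D * (T + e)) (T + e))
  have : Module.Finite ℝ V := Module.Finite.of_basis b1
  have : Module.Finite ℝ (Bd σ ι (D * (T + e)) (T + e)) := Module.Finite.of_basis b2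
  have hle := LinearMap.finrank_le_finrank_of_injective hinj
  rw [Module.finrank_pi_fintype, Finset.sum_const, Module.finrank_eq_nat_card_basis b1,
    Module.finrank_eq_nat_card_basis b2, ncard_degSet, ncard_biSet] at hle
  simpa using hle

lemma bez {D : ℕ} (hD : 1 ≤ D) (G : σ ⊕ ι → MvPolynomial (σ ⊕ ι) ℝ)
    (hG : ∀ t, G t ∈ Bd σ ι D 1) (Z : Finset (σ ⊕ ι → ℝ))
    (hz : ∀ z ∈ Z, ∀ t, eval z (G t) = 0)
    (hnd : ∀ z ∈ Z, ∃ A : (σ ⊕ ι → ℝ) →L[ℝ] (σ ⊕ ι → ℝ), Function.Surjective A ∧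
      HasFDerivAt (fun z t => eval z (G t)) A z) :
    (Z.card : ℝ) ≤ (D : ℝ) ^ Fintype.card σ *
      (Fintype.card σ + Fintype.card ι).choose (Fintype.card σ) := by
  obtain ⟨e, he⟩ := bez_count hD G hG Z hz hnd
  generalize Fintype.card σ = k at *
  generalize Fintype.card ι = m at *
  generalize Z.card = N at *
  have hbound : ∀ T : ℕ, 0 < T → (N : ℝ) ≤ ((D * (T + e) + k : ℝ) / T) ^ k *
      ((T + e + m : ℝ) / T) ^ m * ((k + m).factorial / (k.factorial * m.factorial)) := by
    intro T hT
    have h1 : (N : ℝ) * (T + (k + m)).choose (k + m) ≤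
      (D * (T + e) + k).choose k * ((T + e) + m).choose m := by exact_mod_cast he T
    have h2 : (T : ℝ) ^ (k + m) / (k + m).factorial ≤ (T + (k + m)).choose (k + m) := by
      have h3 := Nat.pow_le_choose (α := ℝ) (k + m) (T + (k + m))
      refine le_trans ?_ h3
      gcongr
      omega
    have h4 := Nat.choose_le_pow_div (α := ℝ) k (D * (T + e) + k)
    have h5 := Nat.choose_le_pow_div (α := ℝ) m (T + e + m)
    have h6 : (N : ℝ) * ((T : ℝ) ^ (k + m) / (k + m).factorial) ≤
        ((D * (T + e) + k : ℕ) : ℝ) ^ k / k.factorial *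
          (((T + e + m : ℕ) : ℝ) ^ m / m.factorial) :=
      calc _ ≤ (N : ℝ) * (T + (k + m)).choose (k + m) := by gcongr
        _ ≤ _ := h1
        _ ≤ _ := by gcongr
    push_cast at h6
    have hT' : (0 : ℝ) < T := by exact_mod_cast hT
    have hf : (0 : ℝ) < (k + m).factorial := by exact_mod_cast Nat.factorial_pos _
    have hpos : 0 < (T : ℝ) ^ (k + m) / (k + m).factorial := by positivity
    rw [← le_div_iff₀ hpos] at h6
    refine h6.trans (le_of_eq ?_)
    rw [div_pow, div_pow, pow_add]
    field_simp
  have hT : Tendsto (fun T : ℕ => (T : ℝ)⁻¹) atTop (𝓝 0) := tendsto_inv_atTop_nhds_zero_nat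
  have hlim1 : Tendsto (fun T : ℕ => (D * (T + e) + k : ℝ) / T) atTop (𝓝 D) := by
    have : Tendsto (fun T : ℕ => (D : ℝ) + (D * e + k) * (T : ℝ)⁻¹) atTop (𝓝 (D + (D * e + k) * 0)) :=
      tendsto_const_nhds.add (tendsto_const_nhds.mul hT)
    simp only [mul_zero, add_zero] at this
    refine this.congr' ?_
    filter_upwards [eventually_gt_atTop 0] with T hT
    have : (T : ℝ) ≠ 0 := by positivity
    field_simp
    ring
  have hlim2 : Tendsto (fun T : ℕ => (T + e + m : ℝ) / T) atTop (𝓝 1) := by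
    have : Tendsto (fun T : ℕ => (1 : ℝ) + (e + m) * (T : ℝ)⁻¹) atTop (𝓝 (1 + (e + m) * 0)) :=
      tendsto_const_nhds.add (tendsto_const_nhds.mul hT)
    simp only [mul_zero, add_zero] at this
    refine this.congr' ?_
    filter_upwards [eventually_gt_atTop 0] with T hT
    have : (T : ℝ) ≠ 0 := by positivity
    field_simp
    ring
  have hlim := ((hlim1.pow k).mul (hlim2.pow m)).mul_const
    (((k + m).factorial : ℝ) / (k.factorial * m.factorial))
  have := ge_of_tendsto hlim (by
    filter_upwards [eventually_gt_atTop 0] with T hT using hbound T hT)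
  rw [Nat.cast_add_choose]
  simpa using this

lemma line_deriv [DecidableEq σ] (f : MvPolynomial σ ℝ) (w : σ → ℝ) (i : σ) :
    HasDerivAt (fun t : ℝ => eval (w + t • (Pi.single i 1 : σ → ℝ)) f) (eval w (pderiv i f)) 0 := by
  induction f using MvPolynomial.induction_on with
  | C a => simpa using hasDerivAt_const (0 : ℝ) a
  | add p q hp hq => simpa using hp.fun_add hq
  | mul_X p j hp =>
    have hX : HasDerivAt (fun t : ℝ => w j + t * (Pi.single i 1 : σ → ℝ) j)
        ((Pi.single i 1 : σ → ℝ) j) 0 := by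
      simpa using ((hasDerivAt_id (0 : ℝ)).mul_const ((Pi.single i 1 : σ → ℝ) j)).const_add (w j)
    have := hp.mul hX
    have e : eval w (pderiv i (p * X j)) = eval w (pderiv i p) * w j +
        eval w p * (Pi.single i 1 : σ → ℝ) j := by
      rw [pderiv_mul, pderiv_X]
      by_cases h : j = i
      · subst h; simp
      · simp [h]
    rw [e]
    simpa [Pi.mul_def] using this

lemma growth (f : MvPolynomial σ ℝ) :
    ∃ K : ℝ, 0 ≤ K ∧ ∀ x : σ → ℝ, |eval x f| ≤ Real.exp (K * (1 + ‖x‖)) := by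
  induction f using MvPolynomial.induction_on with
  | C a =>
    refine ⟨|a|, abs_nonneg _, fun x => ?_⟩
    have h1 := Real.add_one_le_exp (|a| * (1 + ‖x‖))
    have h2 : 0 ≤ |a| * ‖x‖ := by positivity
    simp only [eval_C]
    nlinarith
  | add p q hp hq =>
    obtain ⟨K, hK, h1⟩ := hp
    obtain ⟨L, hL, h2⟩ := hq
    refine ⟨K + L + 1, by positivity, fun x => ?_⟩
    have hx := norm_nonneg x
    have e1 : Real.exp (K * (1 + ‖x‖)) ≤ Real.exp ((K + L) * (1 + ‖x‖)) := by
      apply Real.exp_le_exp.2; nlinarith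
    have e2 : Real.exp (L * (1 + ‖x‖)) ≤ Real.exp ((K + L) * (1 + ‖x‖)) := by
      apply Real.exp_le_exp.2; nlinarith
    have e3 : 2 ≤ Real.exp (1 + ‖x‖) := by
      have := Real.add_one_le_exp (1 + ‖x‖); linarith
    rw [map_add, show (K + L + 1) * (1 + ‖x‖) = (K + L) * (1 + ‖x‖) + (1 + ‖x‖) by ring,
      Real.exp_add]
    have := abs_add_le (eval x p) (eval x q)
    have := h1 x
    have := h2 x
    have := Real.exp_pos ((K + L) * (1 + ‖x‖))
    nlinarith
  | mul_X p j hp =>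
    obtain ⟨K, hK, h1⟩ := hp
    refine ⟨K + 1, by positivity, fun x => ?_⟩
    have hx := norm_nonneg x
    have hj : |x j| ≤ ‖x‖ := norm_le_pi_norm x j
    have e3 : |x j| ≤ Real.exp (1 + ‖x‖) := by
      have := Real.add_one_le_exp (1 + ‖x‖); linarith
    rw [map_mul, eval_X, abs_mul, add_mul, one_mul, Real.exp_add]
    exact mul_le_mul (h1 x) e3 (abs_nonneg _) (Real.exp_pos _).le

lemma sq_bound {p K a r : ℝ} (ha : 0 ≤ a) (hr : 0 ≤ r) (h : p ≤ K + a * r - r ^ 2 / 2) :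
    r ≤ 2 * a + 2 * |K - p| + 1 := by
  by_contra! hc
  have h1 := le_abs_self (K - p)
  have h2 := abs_nonneg (K - p)
  nlinarith [mul_nonneg ha hr, mul_nonneg h2 hr]

lemma exists_crit [DecidableEq σ] (f : ι → MvPolynomial σ ℝ) (b : ι → ℝ) (hb : ∀ j, 0 < b j)
    (c : σ → ℝ) (ε : ι → ℝ) (v : σ → ℝ) (hv : ∀ j, 0 < ε j * eval v (f j)) :
    ∃ w : σ → ℝ, (∀ j, 0 < ε j * eval w (f j)) ∧
      ∀ i, ∑ j, (b j / eval w (f j)) * eval w (pderiv i (f j)) - w i = c i := by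
  classical
  let Q : MvPolynomial σ ℝ := ∑ l, (C (1 / 2) * X l ^ 2 + C (c l) * X l)
  have hQ : ∀ x, eval x Q = ∑ l, (1 / 2 * x l ^ 2 + c l * x l) := fun x => by simp [Q]
  have hQd : ∀ x i, eval x (pderiv i Q) = x i + c i := by
    intro x i
    simp only [Q, map_sum, map_add, pderiv_C_mul, pderiv_pow, map_mul, eval_C, pderiv_X]
    rw [Finset.sum_eq_single i]
    · simp
    · intro l _ hl
      simp [hl]
    · simp
  let P : (σ → ℝ) → ℝ := fun x => (∏ j, |eval x (f j)| ^ b j) * Real.exp (- eval x Q)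
  have hPc : Continuous P := by
    refine Continuous.mul (continuous_finsetProd _ fun j _ => ?_) ?_
    · exact (MvPolynomial.continuous_eval (f j)).abs.rpow_const (fun _ => Or.inr (hb j).le)
    · exact Real.continuous_exp.comp (MvPolynomial.continuous_eval Q).neg
  have hPpos : ∀ x, (∀ j, 0 < ε j * eval x (f j)) → 0 < P x := by
    intro x hx
    refine mul_pos (Finset.prod_pos fun j _ => ?_) (Real.exp_pos _)
    exact Real.rpow_pos_of_pos (abs_pos.2 (right_ne_zero_of_mul (hx j).ne')) _
  have hPexp : ∀ x, (∀ j, 0 < ε j * eval x (f j)) →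
      P x = Real.exp (∑ j, b j * Real.log (eval x (f j)) - eval x Q) := by
    intro x hx
    simp only [P]
    rw [sub_eq_add_neg, Real.exp_add, Real.exp_sum]
    congr 1
    refine Finset.prod_congr rfl fun j _ => ?_
    rw [Real.rpow_def_of_pos (abs_pos.2 (right_ne_zero_of_mul (hx j).ne')), Real.log_abs, mul_comm]
  choose Kf hKf0 hKf using fun j => growth (f j)
  have hbd : ∀ x, P x ≤ Real.exp ((∑ j, Kf j * b j) + ((∑ j, Kf j * b j) + ∑ l, |c l|) * ‖x‖
      - ‖x‖ ^ 2 / 2) := by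
    intro x
    have h1 : ∏ j, |eval x (f j)| ^ b j ≤ Real.exp (∑ j, (Kf j * (1 + ‖x‖)) * b j) := by
      rw [Real.exp_sum]
      refine Finset.prod_le_prod (fun j _ => by positivity) fun j _ => ?_
      rw [Real.exp_mul]
      exact Real.rpow_le_rpow (abs_nonneg _) (hKf j x) (hb j).le
    have h2 : ‖x‖ ^ 2 ≤ ∑ l, x l ^ 2 := by
      have hs : 0 ≤ ∑ l, x l ^ 2 := Finset.sum_nonneg fun _ _ => sq_nonneg _
      rw [← Real.le_sqrt (norm_nonneg _) hs, pi_norm_le_iff_of_nonneg (Real.sqrt_nonneg _)]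
      intro l
      rw [Real.norm_eq_abs]
      apply Real.abs_le_sqrt
      exact Finset.single_le_sum (f := fun l => x l ^ 2) (fun _ _ => sq_nonneg _) (Finset.mem_univ l)
    have h3 : -(∑ l, c l * x l) ≤ (∑ l, |c l|) * ‖x‖ := by
      rw [Finset.sum_mul, ← Finset.sum_neg_distrib]
      refine Finset.sum_le_sum fun l _ => ?_
      have : |c l * x l| ≤ |c l| * ‖x‖ := by
        rw [abs_mul]
        exact mul_le_mul_of_nonneg_left (norm_le_pi_norm x l) (abs_nonneg _)
      exact (neg_le_abs _).trans this
    calc P x ≤ Real.exp (∑ j, (Kf j * (1 + ‖x‖)) * b j) * Real.exp (- eval x Q) :=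
          mul_le_mul_of_nonneg_right h1 (Real.exp_pos _).le
      _ = Real.exp ((∑ j, (Kf j * (1 + ‖x‖)) * b j) + (- eval x Q)) := (Real.exp_add _ _).symm
      _ ≤ _ := by
        apply Real.exp_le_exp.2
        rw [hQ, Finset.sum_add_distrib, ← Finset.mul_sum]
        have : ∑ j, (Kf j * (1 + ‖x‖)) * b j = (∑ j, Kf j * b j) + (∑ j, Kf j * b j) * ‖x‖ := by
          rw [Finset.sum_mul, ← Finset.sum_add_distrib]
          exact Finset.sum_congr rfl fun _ _ => by ring
        rw [this]
        nlinarith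
  let R : Set (σ → ℝ) := {x | ∀ j, 0 ≤ ε j * eval x (f j)}
  have hRc : IsClosed R := by
    simp only [R, Set.ofPred_forall]
    exact isClosed_iInter fun j => isClosed_le continuous_const
      (continuous_const.mul (MvPolynomial.continuous_eval (f j)))
  let S : Set (σ → ℝ) := R ∩ {x | P v ≤ P x}
  have hSc : IsClosed S := hRc.inter (isClosed_le continuous_const hPc)
  have hvS : v ∈ S := ⟨fun j => (hv j).le, le_refl (P v)⟩
  have hPv := hPpos v hv
  have hSb : Bornology.IsBounded S := by
    have hK0 : 0 ≤ ∑ j, Kf j * b j :=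
      Finset.sum_nonneg fun j _ => mul_nonneg (hKf0 j) (hb j).le
    have hc0 : 0 ≤ ∑ l, |c l| := Finset.sum_nonneg fun l _ => abs_nonneg _
    refine (Metric.isBounded_closedBall (x := (0 : σ → ℝ)) (r := 2 * ((∑ j, Kf j * b j) + ∑ l, |c l|) +
      2 * |(∑ j, Kf j * b j) - Real.log (P v)| + 1)).subset fun x hx => ?_
    · rw [mem_closedBall_zero_iff]
      refine sq_bound (p := Real.log (P v)) (add_nonneg hK0 hc0) (norm_nonneg x) ?_
      rw [Real.log_le_iff_le_exp hPv]
      exact le_trans hx.2 (hbd x)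
  have hScomp : IsCompact S := Metric.isCompact_of_isClosed_isBounded hSc hSb
  obtain ⟨w, hwS, hwmax⟩ := hScomp.exists_isMaxOn ⟨v, hvS⟩ hPc.continuousOn
  have hwpos : ∀ j, 0 < ε j * eval w (f j) := by
    intro j
    refine lt_of_le_of_ne (hwS.1 j) fun h0 => ?_
    have hPw : 0 < P w := lt_of_lt_of_le hPv hwS.2
    have hε : ε j ≠ 0 := left_ne_zero_of_mul (hv j).ne'
    have hf0 : eval w (f j) = 0 := (mul_eq_zero.1 h0.symm).resolve_left hε
    have : P w = 0 := by
      simp only [P]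
      rw [Finset.prod_eq_zero (Finset.mem_univ j), zero_mul]
      rw [hf0, abs_zero, Real.zero_rpow (hb j).ne']
    exact hPw.ne' this
  refine ⟨w, hwpos, fun i => ?_⟩
  let ℓ : ℝ → σ → ℝ := fun t => w + t • (Pi.single i 1 : σ → ℝ)
  have hℓ : Continuous ℓ := by fun_prop
  have hℓ0 : ℓ 0 = w := by simp [ℓ]
  let ψ : ℝ → ℝ := fun t => ∑ j, b j * Real.log (eval (ℓ t) (f j)) - eval (ℓ t) Q
  have hd : HasDerivAt ψ (∑ j, b j * (eval w (pderiv i (f j)) / eval w (f j)) - eval w (pderiv i Q)) 0 := by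
    refine HasDerivAt.sub (HasDerivAt.fun_sum fun j _ => ?_) (line_deriv Q w i)
    have h1 := (line_deriv (f j) w i).log (by
      have := right_ne_zero_of_mul (hwpos j).ne'
      simpa using this)
    simp only [zero_smul, add_zero] at h1
    exact h1.const_mul (b j)
  have hmax : IsLocalMax ψ 0 := by
    have hopen : ∀ᶠ t in 𝓝 (0 : ℝ), ∀ j, 0 < ε j * eval (ℓ t) (f j) := by
      rw [eventually_all]
      intro j
      have hc : Continuous fun t => ε j * eval (ℓ t) (f j) :=
        continuous_const.mul ((MvPolynomial.continuous_eval (f j)).comp hℓ)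
      apply hc.continuousAt.eventually (lt_mem_nhds ?_)
      simpa [hℓ0] using hwpos j
    filter_upwards [hopen] with t ht
    have h1 : P (ℓ t) ≤ P w := by
      by_cases h : P v ≤ P (ℓ t)
      · exact hwmax ⟨fun j => (ht j).le, h⟩
      · exact (not_le.1 h).le.trans hwS.2
    rw [hPexp _ ht, hPexp _ hwpos, Real.exp_le_exp] at h1
    simpa [ψ, hℓ0] using h1
  have := hmax.hasDerivAt_eq_zero hd
  rw [hQd] at this
  have h2 : ∑ j, (b j / eval w (f j)) * eval w (pderiv i (f j)) =
      ∑ j, b j * (eval w (pderiv i (f j)) / eval w (f j)) :=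
    Finset.sum_congr rfl fun _ _ => by ring
  rw [h2]
  linarith

lemma Bd_rename {D : ℕ} (p : MvPolynomial σ ℝ) (hp : ∀ γ, coeff γ p ≠ 0 → ∑ i, γ i ≤ D) :
    rename Sum.inl p ∈ Bd σ ι D 0 := by
  rw [mem_restrictSupport_iff]
  intro γ hγ
  obtain ⟨u, rfl, hu⟩ := coeff_rename_ne_zero _ _ _ (mem_support_iff.1 (Finset.mem_coe.1 hγ))
  constructor
  · simpa [Finsupp.mapDomain_apply Sum.inl_injective] using hp u hu
  · refine le_of_eq (Finset.sum_eq_zero fun j _ => ?_)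
    exact Finsupp.mapDomain_of_notMem_range _ _ (by simp)

lemma deg_le {D : ℕ} {p : MvPolynomial σ ℝ} (hp : p.totalDegree ≤ D) :
    ∀ γ, coeff γ p ≠ 0 → ∑ i, γ i ≤ D := by
  intro γ hγ
  have h := le_totalDegree (mem_support_iff.2 hγ)
  rw [Finsupp.sum_fintype _ _ (fun _ => rfl)] at h
  exact h.trans hp

lemma deg_le_pderiv {D : ℕ} {p : MvPolynomial σ ℝ} (hp : p.totalDegree ≤ D) (i : σ) :
    ∀ γ, coeff γ (pderiv i p) ≠ 0 → ∑ i, γ i ≤ D := by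
  intro γ hγ
  rw [coeff_pderiv] at hγ
  have := deg_le hp _ (left_ne_zero_of_mul hγ)
  simp [Finset.sum_add_distrib] at this
  omega

lemma Bd_X_inr (j : ι) : (X (Sum.inr j) : MvPolynomial (σ ⊕ ι) ℝ) ∈ Bd σ ι 0 1 := by
  classical
  rw [X, monomial_mem_restrictSupport]
  left
  constructor
  · simp [Finsupp.single_apply]
  · simp [Finsupp.single_apply]

lemma Bd_X_inl (i : σ) : (X (Sum.inl i) : MvPolynomial (σ ⊕ ι) ℝ) ∈ Bd σ ι 1 0 := by
  classical
  rw [X, monomial_mem_restrictSupport]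
  left
  constructor
  · simp [Finsupp.single_apply]
  · simp [Finsupp.single_apply]

theorem warren {D : ℕ} (hD : 1 ≤ D) (f : ι → MvPolynomial σ ℝ) (hf : ∀ j, (f j).totalDegree ≤ D)
    (hsh : ∀ B : Set ι, ∃ x : σ → ℝ, ∀ j, (j ∈ B → 0 < eval x (f j)) ∧ (j ∉ B → eval x (f j) < 0)) :
    (2 : ℝ) ^ Fintype.card ι ≤ (D : ℝ) ^ Fintype.card σ *
      (Fintype.card σ + Fintype.card ι).choose (Fintype.card σ) := by
  classical
  let H : σ ⊕ ι → MvPolynomial (σ ⊕ ι) ℝ := Sum.elim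
    (fun i => ∑ j, X (Sum.inr j) * rename Sum.inl (pderiv i (f j)) - X (Sum.inl i))
    (fun j => X (Sum.inr j) * rename Sum.inl (f j))
  have hH : ∀ t, H t ∈ Bd σ ι D 1 := by
    rintro (i | j)
    · refine Submodule.sub_mem _ (Submodule.sum_mem _ fun j _ => ?_) ?_
      · have := Bd_mul (Bd_X_inr (σ := σ) j) (Bd_rename (ι := ι) _ (deg_le_pderiv (hf j) i))
        simpa using this
      · exact Bd_mono hD (Nat.zero_le _) (Bd_X_inl i)
    · have := Bd_mul (Bd_X_inr (σ := σ) j) (Bd_rename (ι := ι) _ (deg_le (hf j)))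
      simpa [H] using this
  let F : (σ ⊕ ι → ℝ) → (σ ⊕ ι → ℝ) := fun z t => eval z (H t)
  have hF : Differentiable ℝ F := by
    rw [differentiable_pi]
    intro t z
    exact ((AnalyticOnNhd.eval_mvPolynomial (H t)) z (Set.mem_univ _)).differentiableAt
  let Cr : Set (σ ⊕ ι → ℝ) := {z | (fderiv ℝ F z).det = 0}
  have hsard : volume (F '' Cr) = 0 :=
    addHaar_image_eq_zero_of_det_fderivWithin_eq_zero volume
      (fun z _ => (hF z).hasFDerivAt.hasFDerivWithinAt) (fun z hz => hz)
  obtain ⟨y, hypos, hyreg⟩ : ∃ y : σ ⊕ ι → ℝ, (∀ j, 0 < y (Sum.inr j)) ∧ y ∉ F '' Cr := by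
    by_contra! hc
    have hU : IsOpen {y : σ ⊕ ι → ℝ | ∀ j : ι, 0 < y (Sum.inr j)} := by
      simp only [Set.ofPred_forall]
      exact isOpen_iInter_of_finite fun j => isOpen_lt continuous_const (continuous_apply _)
    have hpos := hU.measure_pos volume ⟨fun _ => 1, fun _ => one_pos⟩
    exact hpos.ne' (measure_mono_null (fun y hy => hc y hy) hsard)
  let ε : Set ι → ι → ℝ := fun B j => if j ∈ B then 1 else -1
  have hw : ∀ B : Set ι, ∃ w : σ → ℝ, (∀ j, 0 < ε B j * eval w (f j)) ∧
      ∀ i, ∑ j, (y (Sum.inr j) / eval w (f j)) * eval w (pderiv i (f j)) - w i = y (Sum.inl i) := by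
    intro B
    obtain ⟨x, hx⟩ := hsh B
    refine exists_crit f (fun j => y (Sum.inr j)) hypos (fun i => y (Sum.inl i)) (ε B) x ?_
    intro j
    by_cases hj : j ∈ B
    · simpa [ε, hj] using (hx j).1 hj
    · simpa [ε, hj] using (hx j).2 hj
  choose w hw1 hw2 using hw
  let z : Set ι → σ ⊕ ι → ℝ := fun B => Sum.elim (w B) (fun j => y (Sum.inr j) / eval (w B) (f j))
  have hzinj : Function.Injective z := by
    intro B B' hBB
    have hww : w B = w B' := funext fun i => congrFun hBB (Sum.inl i)
    ext j
    have h1 := hw1 B j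
    have h2 := hw1 B' j
    rw [hww] at h1
    by_cases hj : j ∈ B <;> by_cases hj' : j ∈ B' <;> simp [ε, hj, hj'] at h1 h2 ⊢ <;> linarith
  have hzF : ∀ B, F (z B) = y := by
    intro B
    have hcomp : (z B) ∘ Sum.inl = w B := rfl
    funext t
    rcases t with i | j
    · simp only [F, H, Sum.elim_inl, map_sub, map_sum, map_mul, eval_X, eval_rename, hcomp]
      exact hw2 B i
    · simp only [F, H, Sum.elim_inr, map_mul, eval_X, eval_rename, hcomp]
      exact div_mul_cancel₀ _ (right_ne_zero_of_mul (hw1 B j).ne')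
  let G : σ ⊕ ι → MvPolynomial (σ ⊕ ι) ℝ := fun t => H t - C (y t)
  have hGF : (fun z t => eval z (G t)) = fun z => F z - y := by
    funext z t
    simp [G, F]
  have hres := bez hD G (fun t => Submodule.sub_mem _ (hH t) (Bd_C _ _ _))
    (Finset.univ.image z) (by
      intro z' hz' t
      obtain ⟨B, _, rfl⟩ := Finset.mem_image.1 hz'
      have := congrFun (hzF B) t
      simpa [G, sub_eq_zero] using this) (by
      intro z' hz'
      obtain ⟨B, _, rfl⟩ := Finset.mem_image.1 hz'
      refine ⟨fderiv ℝ F (z B), ?_, ?_⟩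
      · have hdet : (fderiv ℝ F (z B)).det ≠ 0 := fun h0 => hyreg ⟨z B, h0, hzF B⟩
        exact (LinearMap.equivOfDetNeZero _ hdet).surjective
      · rw [hGF]
        exact (hF (z B)).hasFDerivAt.sub_const y)
  rw [Finset.card_image_of_injective _ hzinj, Finset.card_univ, Fintype.card_set] at hres
  exact_mod_cast hres

lemma numeric {k m n : ℕ} (hk : 0 < k) (hn : 1 ≤ n)
    (h : (2 : ℝ) ^ m ≤ (n : ℝ) ^ k * (k + m).choose k) :
    (m : ℝ) ≤ 2 * k * Real.logb 2 (4 * Real.exp 1 * n) := by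
  by_contra! hc
  have hk' : (0 : ℝ) < k := by exact_mod_cast hk
  have hn' : (1 : ℝ) ≤ n := by exact_mod_cast hn
  have he := Real.exp_pos 1
  have hpos : 0 < 4 * Real.exp 1 * n := by positivity
  set t : ℝ := (m : ℝ) / k with ht
  have hm : (m : ℝ) = t * k := by rw [ht]; field_simp
  have ht0 : 0 ≤ t := by positivity
  have h1 : Real.logb 2 (4 * Real.exp 1 * n) < t / 2 := by
    rw [hm] at hc
    nlinarith
  have h2 : 4 * Real.exp 1 * n < (2 : ℝ) ^ (t / 2) := by
    rwa [Real.logb_lt_iff_lt_rpow (by norm_num) hpos] at h1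
  have h3 : (t + 1) / 4 ≤ (2 : ℝ) ^ (t / 2) := by
    have hl : (1 / 2 : ℝ) ≤ Real.log 2 := by have := Real.log_two_gt_d9; linarith
    rw [Real.rpow_def_of_pos (by norm_num)]
    have := Real.add_one_le_exp (Real.log 2 * (t / 2))
    nlinarith
  have h4 : Real.exp 1 * n * (t + 1) < (2 : ℝ) ^ t := by
    have e : (2 : ℝ) ^ t = (2 : ℝ) ^ (t / 2) * (2 : ℝ) ^ (t / 2) := by
      rw [← Real.rpow_add (by norm_num)]; congr 1; ring
    rw [e]
    have hp : 0 < (t + 1) / 4 := by positivity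
    calc Real.exp 1 * n * (t + 1) = (4 * Real.exp 1 * n) * ((t + 1) / 4) := by ring
      _ < (2 : ℝ) ^ (t / 2) * ((t + 1) / 4) := mul_lt_mul_of_pos_right h2 hp
      _ ≤ _ := mul_le_mul_of_nonneg_left h3 (by positivity)
  have h5 : (Real.exp 1 * n * (t + 1)) ^ k < (2 : ℝ) ^ m := by
    have e : (2 : ℝ) ^ m = ((2 : ℝ) ^ t) ^ k := by
      rw [← Real.rpow_natCast, ← Real.rpow_natCast, ← Real.rpow_mul (by norm_num), hm]
    rw [e]
    exact pow_lt_pow_left₀ h4 (by positivity) hk.ne'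
  have h6 : ((k + m).choose k : ℝ) ≤ (Real.exp 1 * (t + 1)) ^ k := by
    have h7 := Nat.choose_le_pow_div (α := ℝ) k (k + m)
    have h8 : (k : ℝ) ^ k / k.factorial ≤ Real.exp k := Real.pow_div_factorial_le_exp _ hk'.le _
    have e : (((k + m : ℕ) : ℝ)) = k * (t + 1) := by
      push_cast; rw [hm]; ring
    rw [e, mul_pow, mul_div_right_comm] at h7
    refine h7.trans ?_
    rw [mul_pow, ← Real.exp_nat_mul, mul_one]
    exact mul_le_mul_of_nonneg_right h8 (by positivity)
  have h9 : (n : ℝ) ^ k * (k + m).choose k ≤ (Real.exp 1 * n * (t + 1)) ^ k := by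
    calc _ ≤ (n : ℝ) ^ k * (Real.exp 1 * (t + 1)) ^ k := by gcongr
      _ = _ := by rw [← mul_pow]; congr 1; ring
  linarith

/-- The hidden Markov density as a polynomial in the transition matrix. -/
noncomputable def hmmPoly (M n d : ℕ) (hn : 0 < n) (pi0 : Fin M → ℝ)
    (pch : Fin M → (Fin d → ℝ) → ℝ) (b : Bool) (x : Fin n → Fin d → ℝ) :
    MvPolynomial (Bool × Fin M × Fin M) ℝ :=
  ∑ s : Fin n → Fin M,
    C (pi0 (s ⟨0, hn⟩) * (∏ i, pch (s i) (x i))) *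
      ∏ i : Fin n, if h : (i : ℕ) + 1 < n then X (b, s i, s ⟨(i : ℕ) + 1, h⟩) else 1

lemma hmmPoly_deg (M n d : ℕ) (hn : 0 < n) (pi0 : Fin M → ℝ)
    (pch : Fin M → (Fin d → ℝ) → ℝ) (b : Bool) (x : Fin n → Fin d → ℝ) :
    (hmmPoly M n d hn pi0 pch b x).totalDegree ≤ n := by
  refine totalDegree_finsetSum_le fun s _ => ?_
  refine (totalDegree_mul _ _).trans ?_
  rw [totalDegree_C, zero_add]
  refine (totalDegree_finsetProd _ _).trans ?_
  calc _ ≤ ∑ i : Fin n, 1 := by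
        refine Finset.sum_le_sum fun i _ => ?_
        split_ifs
        · exact (totalDegree_X _).le
        · simp
    _ = n := by simp

lemma hmmPoly_eval (M n d : ℕ) (hn : 0 < n) (pi0 : Fin M → ℝ)
    (pch : Fin M → (Fin d → ℝ) → ℝ) (b : Bool) (x : Fin n → Fin d → ℝ)
    (θ : Bool × Fin M × Fin M → ℝ) :
    eval θ (hmmPoly M n d hn pi0 pch b x) =
      hmmDensity M n d hn pi0 pch (fun i j => θ (b, i, j)) x := by
  simp only [hmmPoly, hmmDensity, map_sum, map_mul, eval_C, map_prod]
  refine Finset.sum_congr rfl fun s _ => ?_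
  congr 1
  refine Finset.prod_congr rfl fun i _ => ?_
  split_ifs <;> simp

end HmmVC

open MvPolynomial Filter Topology

/-- **VC dimension of the Yatracos class of hidden Markov output densities.** For a hidden
Markov process with `M` states, fixed initial probability vector `π`, fixed channel densities
`p(·|s)` on `ℝ^d`, and transition matrix `θ = [a_{ij}] ∈ ℝ^{M×M}`, the Yatracos class
`𝒜_n = { {xⁿ : p_θ(xⁿ) > p_{θ'}(xⁿ)} : θ ≠ θ' }` of the `n`-dimensional output densities is
a VC class with VC dimension at most `4M² log₂(4en)`. -/
theorem stmt_12 (M n d : ℕ) (hM : 1 ≤ M) (hn : 2 ≤ n) (hn0 : 0 < n)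
    (pi0 : Fin M → ℝ) (hpi0 : ∀ s, 0 ≤ pi0 s) (hpi0sum : ∑ s, pi0 s = 1)
    (pch : Fin M → (Fin d → ℝ) → ℝ)
    (hpchmeas : ∀ s, Measurable (pch s))
    (hpchnn : ∀ s x, 0 ≤ pch s x)
    (hpchint : ∀ s, ∫ x : Fin d → ℝ, pch s x = 1)
    (𝒜 : Set (Set (Fin n → Fin d → ℝ)))
    (h𝒜 : 𝒜 = {A | ∃ a a' : Fin M → Fin M → ℝ, a ≠ a' ∧
      A = {x | hmmDensity M n d hn0 pi0 pch a' x < hmmDensity M n d hn0 pi0 pch a x}}) :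
    ∀ S : Finset (Fin n → Fin d → ℝ), Shatters 𝒜 S →
      (S.card : ℝ) ≤ 4 * M ^ 2 * Real.logb 2 (4 * Real.exp 1 * n) := by
  classical
  intro S hS
  subst h𝒜
  let g : S → MvPolynomial (Bool × Fin M × Fin M) ℝ := fun z =>
    HmmVC.hmmPoly M n d hn0 pi0 pch true z.1 - HmmVC.hmmPoly M n d hn0 pi0 pch false z.1
  have hg : ∀ B : Set S, ∃ θ : Bool × Fin M × Fin M → ℝ, ∀ z : S, z ∈ B ↔ 0 < eval θ (g z) := by
    intro B
    obtain ⟨A, ⟨a, a', -, rfl⟩, hA⟩ := hS (S.filter fun z => ∃ h : z ∈ S, (⟨z, h⟩ : S) ∈ B)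
      (Finset.filter_subset _ _)
    refine ⟨fun t => if t.1 then a t.2.1 t.2.2 else a' t.2.1 t.2.2, fun z => ?_⟩
    have h1 := hA z.1 z.2
    simp only [g, map_sub, HmmVC.hmmPoly_eval, sub_pos]
    have h2 : (z.1 ∈ S.filter fun z => ∃ h : z ∈ S, (⟨z, h⟩ : S) ∈ B) ↔ z ∈ B := by
      simp
    rw [← h2, ← h1]
    simp
  choose θ hθ using hg
  have hη : ∀ᶠ η in 𝓝[>] (0 : ℝ), ∀ B : Set S, ∀ z : S, 0 < eval (θ B) (g z) →
      η < eval (θ B) (g z) := by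
    rw [eventually_all]
    intro B
    rw [eventually_all]
    intro z
    by_cases h : 0 < eval (θ B) (g z)
    · filter_upwards [nhdsWithin_le_nhds (gt_mem_nhds h)] with η h1 _ using h1
    · exact Eventually.of_forall fun η h1 => absurd h1 h
  obtain ⟨η, hη1, hη0⟩ := (hη.and self_mem_nhdsWithin).exists
  have hη0 : 0 < η := hη0
  have key := HmmVC.warren (D := n) hn0 (fun z => g z - C η) (by
    intro z
    refine (totalDegree_sub _ _).trans (max_le ?_ (by simp))
    exact (totalDegree_sub _ _).trans
      (max_le (HmmVC.hmmPoly_deg ..) (HmmVC.hmmPoly_deg ..))) (by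
    intro B
    refine ⟨θ B, fun z => ⟨fun hz => ?_, fun hz => ?_⟩⟩
    · simpa using hη1 B z ((hθ B z).1 hz)
    · have : ¬ 0 < eval (θ B) (g z) := fun h => hz ((hθ B z).2 h)
      simp only [map_sub, eval_C]
      linarith)
  have hk : Fintype.card (Bool × Fin M × Fin M) = 2 * M ^ 2 := by
    simp [sq]
  rw [hk, Fintype.card_coe] at key
  have := HmmVC.numeric (by positivity) hn0 key
  refine this.trans (le_of_eq ?_)
  push_cast
  ring
end
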